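/- arXiv:1512.07338 — 5 statements merged into one kernel-verified Lean document; each statement's English description precedes it below -/
import Mathlib

section
/- N(0) = 2 and N(1) = 2; that is, with zero weighings (and also with one weighing) the FC-problem is solvable for 2 coins, and with one weighing it is not solvable for any number of coins exceeding 2. -/
/-- An adaptive strategy for balance weighings on `N` coins: a ternary decision
tree.  At a `weigh A B` node the sets `A` and `B` are placed on the two pans,
and the strategy branches on the outcome (`.lt`: left pan lighter, `.eq`:
balance, `.gt`: right pan lighter).  A leaf `output S` outputs the set `S` of
coins. -/
inductive FCTree (N : ℕ) : Type
  | output (S : Finset (Fin N)) : FCTree N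
  | weigh (A B : Finset (Fin N)) (child : Ordering → FCTree N) : FCTree N

namespace FCTree

/-- The depth (number of weighings in the worst case) of a strategy. -/
def depth {N : ℕ} : FCTree N → ℕ
  | output _ => 0
  | weigh _ _ child =>
      1 + max (depth (child .lt)) (max (depth (child .eq)) (depth (child .gt)))

/-- A strategy is well-formed if in every weighing the two pans are disjoint. -/
def WF {N : ℕ} : FCTree N → Prop
  | output _ => True
  | weigh A B child => Disjoint A B ∧ ∀ o, WF (child o)

end FCTree

/-- Weight of coin `x` when `f` is the fake coin, `c` is the chameleon, and the
chameleon chooses to weigh as a fake coin iff `b = true`.  Real coins weigh `1`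
and the (lighter) fake coin weighs `0`. -/
def coinWeight {N : ℕ} (f c : Fin N) (b : Bool) (x : Fin N) : ℕ :=
  if x = f then 0 else if x = c ∧ b = true then 0 else 1

/-- The outcome of weighing pan `A` against pan `B`, with fake `f`, chameleon
`c`, and chameleon choice `b`. -/
def weighOutcome {N : ℕ} (f c : Fin N) (b : Bool) (A B : Finset (Fin N)) : Ordering :=
  compare (∑ x ∈ A, coinWeight f c b x) (∑ x ∈ B, coinWeight f c b x)

/-- `Reaches f c t S` holds if, with fake coin `f` and chameleon `c`, some
sequence of choices by the chameleon (one choice before each weighing,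
independently) leads the strategy `t` to output the set `S`. -/
inductive Reaches {N : ℕ} (f c : Fin N) : FCTree N → Finset (Fin N) → Prop
  | output (S : Finset (Fin N)) : Reaches f c (.output S) S
  | weigh (A B : Finset (Fin N)) (child : Ordering → FCTree N) (b : Bool)
      (S : Finset (Fin N)) :
      Reaches f c (child (weighOutcome f c b A B)) S →
      Reaches f c (.weigh A B child) S

/-- `t` is an FC-solution for `N` coins in `w` weighings: a well-formed strategy
of depth at most `w` which, for every placement of the fake coin and the
chameleon and every sequence of choices by the chameleon, outputs a set of at
most 2 coins containing the fake coin. -/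
def IsFCSolution {N : ℕ} (t : FCTree N) (w : ℕ) : Prop :=
  t.WF ∧ t.depth ≤ w ∧
    ∀ f c : Fin N, f ≠ c → ∀ S, Reaches f c t S → S.card ≤ 2 ∧ f ∈ S

/-- There is an FC-algorithm in `w` weighings for `N` coins. -/
def FCAlgorithm (N w : ℕ) : Prop := ∃ t : FCTree N, IsFCSolution t w

/-- `FC N` is the least number of weighings `w` for which an FC-algorithm in
`w` weighings for `N` coins exists. -/
noncomputable def FC (N : ℕ) : ℕ := sInf {w | FCAlgorithm N w}

/-- Weight of coin `x` in the FF-problem with fake coins `f₁` and `f₂`. -/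
def ffWeight {N : ℕ} (f₁ f₂ x : Fin N) : ℕ := if x = f₁ ∨ x = f₂ then 0 else 1

/-- The (deterministic) run of a strategy in the FF-problem with fake coins
`f₁` and `f₂`; it returns the output set. -/
def ffRun {N : ℕ} (f₁ f₂ : Fin N) : FCTree N → Finset (Fin N)
  | .output S => S
  | .weigh A B child =>
      ffRun f₁ f₂
        (child (compare (∑ x ∈ A, ffWeight f₁ f₂ x) (∑ x ∈ B, ffWeight f₁ f₂ x)))

/-- There is an FF-algorithm in `w` weighings for `N` coins: a well-formed
strategy of depth at most `w` that identifies both fake coins for every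
placement of the two fake coins. -/
def FFAlgorithm (N w : ℕ) : Prop :=
  ∃ t : FCTree N, t.WF ∧ t.depth ≤ w ∧
    ∀ f₁ f₂ : Fin N, f₁ ≠ f₂ → ffRun f₁ f₂ t = {f₁, f₂}

/-- The group (of three coins) to which a coin of the scaled problem belongs. -/
def coinGroup {N : ℕ} (x : Fin (3 * N)) : Fin N :=
  ⟨x.val / 3, by have := x.isLt; omega⟩

/-- The set of coins of the scaled problem whose group lies in `A`. -/
def expandPan {N : ℕ} (A : Finset (Fin N)) : Finset (Fin (3 * N)) :=
  Finset.univ.filter (fun x => coinGroup x ∈ A)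

/-- The scaling of a strategy, extended at the leaves: every coin is replaced
by a group of three coins, every weighing is performed on the corresponding
groups, and every leaf `output S` is replaced by the strategy `ext S`. -/
def scaleExtend {N : ℕ} (ext : Finset (Fin N) → FCTree (3 * N)) :
    FCTree N → FCTree (3 * N)
  | .output S => ext S
  | .weigh A B child =>
      .weigh (expandPan A) (expandPan B) (fun o => scaleExtend ext (child o))

/-- A `(w,N)`-solution `t` is scalable if its scaling can be extended by (at
most) two further weighings at each leaf to a `(w+2, 3N)`-solution. -/
def IsScalable {N : ℕ} (t : FCTree N) (w : ℕ) : Prop :=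
  ∃ ext : Finset (Fin N) → FCTree (3 * N),
    (∀ S, (ext S).WF ∧ (ext S).depth ≤ 2) ∧
    IsFCSolution (scaleExtend ext t) (w + 2)

theorem sum_coinWeight_add {N : ℕ} {f c : Fin N} (hfc : f ≠ c) (b : Bool) (A : Finset (Fin N)) :
    ∑ x ∈ A, coinWeight f c b x + (if f ∈ A then 1 else 0) +
      (if c ∈ A ∧ b = true then 1 else 0) = A.card := by
  have hf : (if f ∈ A then 1 else 0) = ∑ x ∈ A, if x = f then 1 else 0 := by simp
  have hc : (if c ∈ A ∧ b = true then 1 else 0) =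
      ∑ x ∈ A, if x = c ∧ b = true then 1 else 0 := by
    cases b <;> simp
  rw [hf, hc, ← Finset.sum_add_distrib, ← Finset.sum_add_distrib, Finset.card_eq_sum_ones]
  refine Finset.sum_congr rfl fun x _ => ?_
  unfold coinWeight
  by_cases hxf : x = f
  · simp [hxf, hfc]
  · by_cases hxc : x = c ∧ b = true <;> simp [hxf, hxc, hfc.symm]

theorem weighOutcome_swap {N : ℕ} (f c : Fin N) (b : Bool) (A B : Finset (Fin N)) :
    weighOutcome f c b B A = (weighOutcome f c b A B).swap :=
  Std.OrientedOrd.eq_swap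

/-- If the left pan holds at least as many coins as the right one, some single outcome is
compatible with every coin being the fake. -/
theorem exists_common_outcome_of_card_le {N : ℕ} (hN : 2 ≤ N) {A B : Finset (Fin N)}
    (hAB : Disjoint A B) (hle : B.card ≤ A.card) :
    ∃ o, ∀ f, ∃ c, f ≠ c ∧ ∃ b, weighOutcome f c b A B = o := by
  have : Nontrivial (Fin N) := Fin.nontrivial_iff_two_le.mpr hN
  have hdisj : ∀ x ∈ A, x ∉ B := fun _ hx => Finset.disjoint_left.mp hAB hx
  rcases hle.eq_or_lt with heq | hlt
  · refine ⟨.eq, fun f => ?_⟩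
    by_cases hfA : f ∈ A
    · obtain ⟨c, hc⟩ := Finset.card_pos.mp (heq ▸ Finset.card_pos.mpr ⟨f, hfA⟩)
      have hfc : f ≠ c := fun h => hdisj f hfA (h ▸ hc)
      have hcA : c ∉ A := fun h => hdisj c h hc
      refine ⟨c, hfc, true, compare_eq_iff_eq.mpr ?_⟩
      have h1 := sum_coinWeight_add hfc true A
      have h2 := sum_coinWeight_add hfc true B
      simp [hfA, hcA, hdisj f hfA, hc] at h1 h2
      omega
    · by_cases hfB : f ∈ B
      · obtain ⟨c, hc⟩ := Finset.card_pos.mp (heq ▸ Finset.card_pos.mpr ⟨f, hfB⟩)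
        have hfc : f ≠ c := fun h => hfA (h ▸ hc)
        refine ⟨c, hfc, true, compare_eq_iff_eq.mpr ?_⟩
        have h1 := sum_coinWeight_add hfc true A
        have h2 := sum_coinWeight_add hfc true B
        simp [hfA, hc, hfB, hdisj c hc] at h1 h2
        omega
      · obtain ⟨c, hc⟩ := exists_ne f
        refine ⟨c, hc.symm, false, compare_eq_iff_eq.mpr ?_⟩
        have h1 := sum_coinWeight_add hc.symm false A
        have h2 := sum_coinWeight_add hc.symm false B
        simp [hfA, hfB] at h1 h2
        omega
  · by_cases hone : A.card = 1
    · have hB : B = ∅ := Finset.card_eq_zero.mp (by omega)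
      obtain ⟨x, rfl⟩ := Finset.card_eq_one.mp hone
      subst hB
      refine ⟨.eq, fun f => ?_⟩
      by_cases hfx : f = x
      · obtain ⟨c, hc⟩ := exists_ne f
        exact ⟨c, hc.symm, false, by simp [weighOutcome, coinWeight, hfx]⟩
      · exact ⟨x, hfx, true, by simp [weighOutcome, coinWeight]⟩
    · refine ⟨.gt, fun f => ?_⟩
      by_cases hfA : f ∈ A ∧ B.Nonempty
      · obtain ⟨hfA, c, hc⟩ := hfA
        have hfc : f ≠ c := fun h => hdisj f hfA (h ▸ hc)
        have hcA : c ∉ A := fun h => hdisj c h hc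
        refine ⟨c, hfc, true, compare_gt_iff_gt.mpr ?_⟩
        have h1 := sum_coinWeight_add hfc true A
        have h2 := sum_coinWeight_add hfc true B
        simp [hfA, hcA, hdisj f hfA, hc] at h1 h2
        omega
      · obtain ⟨c, hc⟩ := exists_ne f
        refine ⟨c, hc.symm, false, compare_gt_iff_gt.mpr ?_⟩
        have h1 := sum_coinWeight_add hc.symm false A
        have h2 := sum_coinWeight_add hc.symm false B
        by_cases hf : f ∈ A
        · have hB : B.card = 0 := by simpa [hf] using hfA
          simp [hf] at h1 h2
          omega
        · simp [hf] at h1 h2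
          omega

/-- Every single weighing has an outcome compatible with every coin being the fake. -/
theorem exists_common_outcome {N : ℕ} (hN : 2 ≤ N) {A B : Finset (Fin N)} (hAB : Disjoint A B) :
    ∃ o, ∀ f, ∃ c, f ≠ c ∧ ∃ b, weighOutcome f c b A B = o := by
  rcases le_total B.card A.card with h | h
  · exact exists_common_outcome_of_card_le hN hAB h
  · obtain ⟨o, ho⟩ := exists_common_outcome_of_card_le hN hAB.symm h
    refine ⟨o.swap, fun f => ?_⟩
    obtain ⟨c, hfc, b, hb⟩ := ho f
    exact ⟨c, hfc, b, by rw [weighOutcome_swap, hb]⟩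

theorem FCTree.exists_eq_output_of_depth_eq_zero {N : ℕ} {t : FCTree N} (ht : t.depth = 0) :
    ∃ S, t = .output S := by
  cases t with
  | output S => exact ⟨S, rfl⟩
  | weigh A B child => simp [FCTree.depth] at ht

theorem FCAlgorithm.mono {N w w' : ℕ} (hw : w ≤ w') (h : FCAlgorithm N w) : FCAlgorithm N w' := by
  obtain ⟨t, hwf, hd, ht⟩ := h
  exact ⟨t, hwf, hd.trans hw, ht⟩

theorem fcAlgorithm_two_zero : FCAlgorithm 2 0 := by
  refine ⟨.output Finset.univ, trivial, le_rfl, fun f c _ S hS => ?_⟩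
  cases hS
  simp

/-- An output set reached for every choice of the fake coin has to contain all the coins. -/
theorem IsFCSolution.le_two_of_forall_reaches {N w : ℕ} {t : FCTree N} (ht : IsFCSolution t w)
    (hN : 0 < N) {S : Finset (Fin N)} (hS : ∀ f, ∃ c, f ≠ c ∧ Reaches f c t S) : N ≤ 2 := by
  have hout : ∀ f, S.card ≤ 2 ∧ f ∈ S := fun f => by
    obtain ⟨c, hfc, hr⟩ := hS f
    exact ht.2.2 f c hfc S hr
  have huniv : S = Finset.univ := Finset.eq_univ_of_forall fun f => (hout f).2
  simpa [huniv] using (hout ⟨0, hN⟩).1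

theorem not_fcAlgorithm_one {N : ℕ} (hN : 2 < N) : ¬ FCAlgorithm N 1 := by
  rintro ⟨t, ht⟩
  have : Nontrivial (Fin N) := Fin.nontrivial_iff_two_le.mpr hN.le
  refine hN.not_ge ?_
  cases t with
  | output S =>
    refine ht.le_two_of_forall_reaches (by omega) (S := S) fun f => ?_
    obtain ⟨c, hc⟩ := exists_ne f
    exact ⟨c, hc.symm, .output S⟩
  | weigh A B child =>
    have hdepth := ht.2.1
    obtain ⟨o, ho⟩ := exists_common_outcome hN.le ht.1.1
    have hchild : (child o).depth = 0 := by
      simp only [FCTree.depth] at hdepth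
      cases o <;> omega
    obtain ⟨S, hS⟩ := FCTree.exists_eq_output_of_depth_eq_zero hchild
    refine ht.le_two_of_forall_reaches (by omega) (S := S) fun f => ?_
    obtain ⟨c, hfc, b, hb⟩ := ho f
    refine ⟨c, hfc, .weigh A B child b S ?_⟩
    rw [hb, hS]
    exact .output S

/-- N(0) = 2 and N(1) = 2: with zero weighings (and also with one weighing) the
FC-problem is solvable for 2 coins, and with zero or one weighing it is not
solvable for any number of coins exceeding 2. -/
theorem fc_N_zero_eq_two_and_N_one_eq_two :
    FCAlgorithm 2 0 ∧ FCAlgorithm 2 1 ∧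
    (∀ N : ℕ, 2 < N → ¬ FCAlgorithm N 0) ∧
    (∀ N : ℕ, 2 < N → ¬ FCAlgorithm N 1) := by
  exact ⟨fcAlgorithm_two_zero, fcAlgorithm_two_zero.mono zero_le_one,
    fun _ hN h => not_fcAlgorithm_one hN (h.mono zero_le_one),
    fun _ hN => not_fcAlgorithm_one hN⟩
end

section
/- N(2) = 4; that is, there is an FC-algorithm in 2 weighings for 4 coins, and no FC-algorithm in 2 weighings exists for 5 or more coins. -/
namespace FCTree

/-- The finite set of outputs occurring at the leaves of a strategy. -/
def leafOutputs {N : ℕ} : FCTree N → Finset (Finset (Fin N))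
  | output S => {S}
  | weigh _ _ child =>
      leafOutputs (child .lt) ∪ (leafOutputs (child .eq) ∪ leafOutputs (child .gt))

theorem card_leafOutputs_le {N : ℕ} (t : FCTree N) : t.leafOutputs.card ≤ 3 ^ t.depth := by
  induction t with
  | output S => simp [leafOutputs, depth]
  | weigh A B child ih =>
    set d := max (child .lt).depth (max (child .eq).depth (child .gt).depth) with hd
    have hbound (o : Ordering) : (child o).leafOutputs.card ≤ 3 ^ d :=
      (ih o).trans (Nat.pow_le_pow_right (by norm_num) (by cases o <;> omega))
    have hunion := Finset.card_union_le (child .lt).leafOutputs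
      ((child .eq).leafOutputs ∪ (child .gt).leafOutputs)
    have hunion' := Finset.card_union_le (child .eq).leafOutputs (child .gt).leafOutputs
    have hpow : 3 ^ (weigh A B child).depth = 3 * 3 ^ d := by
      rw [depth, ← hd, pow_add, pow_one]
    have hlt := hbound .lt
    have heq := hbound .eq
    have hgt := hbound .gt
    rw [hpow, leafOutputs]
    omega

end FCTree

theorem Reaches.mem_leafOutputs {N : ℕ} {f c : Fin N} {t : FCTree N} {S : Finset (Fin N)}
    (h : Reaches f c t S) : S ∈ t.leafOutputs := by
  induction h with
  | output S => simp [FCTree.leafOutputs]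
  | weigh A B child b S _ ih =>
    rw [FCTree.leafOutputs]
    cases ho : weighOutcome f c b A B <;> simp_all

theorem coinWeight_true {N : ℕ} (f c x : Fin N) : coinWeight f c true x = ffWeight f c x := by
  by_cases hf : x = f <;> simp [coinWeight, ffWeight, hf]

/-- If the chameleon always weighs as a fake coin, the strategy runs as in the FF-problem. -/
theorem reaches_ffRun {N : ℕ} (f c : Fin N) (t : FCTree N) : Reaches f c t (ffRun f c t) := by
  induction t with
  | output S => exact .output S
  | weigh A B child ih =>
    refine .weigh A B child true _ ?_
    simpa only [weighOutcome, coinWeight_true, ffRun] using ih _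

theorem ffRun_comm {N : ℕ} (f c : Fin N) (t : FCTree N) : ffRun f c t = ffRun c f t := by
  have hweight : ffWeight f c = ffWeight c f := funext fun x => by simp [ffWeight, or_comm]
  induction t with
  | output S => rfl
  | weigh A B child ih => simp only [ffRun, hweight, ih]

theorem IsFCSolution.ffRun_eq {N w : ℕ} {t : FCTree N} (ht : IsFCSolution t w) {f c : Fin N}
    (hfc : f ≠ c) : ffRun f c t = {f, c} := by
  obtain ⟨hcard, hf⟩ := ht.2.2 f c hfc _ (reaches_ffRun f c t)
  have hc := (ht.2.2 c f hfc.symm _ (reaches_ffRun c f t)).2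
  rw [ffRun_comm] at hc
  refine (Finset.eq_of_subset_of_card_le ?_ ?_).symm
  · simp [Finset.insert_subset_iff, hf, hc]
  · rwa [Finset.card_pair hfc]

/-- Every pair of coins is the output of some leaf, which bounds the number of coins. -/
theorem FCAlgorithm.choose_two_le {N w : ℕ} (h : FCAlgorithm N w) : N.choose 2 ≤ 3 ^ w := by
  obtain ⟨t, ht⟩ := h
  have hsub : Finset.powersetCard 2 (Finset.univ : Finset (Fin N)) ⊆ t.leafOutputs := by
    intro P hP
    obtain ⟨f, c, hfc, rfl⟩ := Finset.card_eq_two.mp (Finset.mem_powersetCard.mp hP).2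
    rw [← ht.ffRun_eq hfc]
    exact (reaches_ffRun f c t).mem_leafOutputs
  calc N.choose 2 = (Finset.powersetCard 2 (Finset.univ : Finset (Fin N))).card := by simp
    _ ≤ t.leafOutputs.card := Finset.card_le_card hsub
    _ ≤ 3 ^ t.depth := t.card_leafOutputs_le
    _ ≤ 3 ^ w := Nat.pow_le_pow_right (by norm_num) ht.2.1

theorem reaches_output_iff {N : ℕ} {f c : Fin N} {S T : Finset (Fin N)} :
    Reaches f c (.output S) T ↔ T = S :=
  ⟨fun h => by cases h; rfl, fun h => h ▸ .output T⟩

theorem reaches_weigh_iff {N : ℕ} {f c : Fin N} {A B : Finset (Fin N)}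
    {child : Ordering → FCTree N} {S : Finset (Fin N)} :
    Reaches f c (.weigh A B child) S ↔ ∃ b, Reaches f c (child (weighOutcome f c b A B)) S :=
  ⟨fun h => by cases h with | weigh _ _ _ b _ h => exact ⟨b, h⟩,
    fun ⟨b, h⟩ => .weigh A B child b S h⟩

/-- The second pair of pans of the strategy `fourCoinTree`, given the first outcome. -/
def fourCoinPans : Ordering → Finset (Fin 4) × Finset (Fin 4)
  | .eq => ({0, 1}, {2, 3})
  | _ => ({2}, {3})

/-- The output of the strategy `fourCoinTree`, given the two outcomes. -/
def fourCoinOutput : Ordering → Ordering → Finset (Fin 4)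
  | .lt, .lt => {0, 2}
  | .lt, .eq => {0}
  | .lt, .gt => {0, 3}
  | .eq, .lt => {0, 1}
  | .eq, _ => {2, 3}
  | .gt, .lt => {1, 2}
  | .gt, .eq => {1}
  | .gt, .gt => {1, 3}

/-- A strategy in two weighings for four coins. -/
def fourCoinTree : FCTree 4 :=
  .weigh {0} {1} fun o =>
    .weigh (fourCoinPans o).1 (fourCoinPans o).2 fun o' => .output (fourCoinOutput o o')

theorem fourCoinOutput_spec : ∀ f c : Fin 4, f ≠ c → ∀ b b' : Bool,
    let o := weighOutcome f c b {0} {1}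
    let o' := weighOutcome f c b' (fourCoinPans o).1 (fourCoinPans o).2
    (fourCoinOutput o o').card ≤ 2 ∧ f ∈ fourCoinOutput o o' := by
  decide

theorem isFCSolution_fourCoinTree : IsFCSolution fourCoinTree 2 := by
  refine ⟨⟨by decide, fun o => ⟨by cases o <;> decide, fun _ => trivial⟩⟩, le_rfl, ?_⟩
  intro f c hfc S hS
  simp only [fourCoinTree, reaches_weigh_iff, reaches_output_iff] at hS
  obtain ⟨b, b', rfl⟩ := hS
  exact fourCoinOutput_spec f c hfc b b'

/-- N(2) = 4: there is an FC-algorithm in 2 weighings for 4 coins, and no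
FC-algorithm in 2 weighings exists for more than 4 coins. -/
theorem fc_N_two_eq_four :
    FCAlgorithm 4 2 ∧ ∀ N : ℕ, 4 < N → ¬ FCAlgorithm N 2 := by
  refine ⟨⟨fourCoinTree, isFCSolution_fourCoinTree⟩, fun N hN h => ?_⟩
  have hfive : Nat.choose 5 2 ≤ N.choose 2 := Nat.choose_le_choose 2 hN
  have hnine := hfive.trans h.choose_two_le
  norm_num [Nat.choose] at hnine
end

section
/- N(3) = 6; that is, there is an FC-algorithm in 3 weighings for 6 coins, and no FC-algorithm in 3 weighings exists for 7 or more coins. -/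
/-- With fake coin `f` and chameleon `c`, every run of `t` outputs at most two coins,
among them `f`. -/
def Solves {N : ℕ} (t : FCTree N) (f c : Fin N) : Prop :=
  ∀ S, Reaches f c t S → S.card ≤ 2 ∧ f ∈ S

theorem solves_output {N : ℕ} {S : Finset (Fin N)} {f c : Fin N} :
    Solves (.output S) f c ↔ S.card ≤ 2 ∧ f ∈ S := by
  constructor
  · exact fun h => h S (.output S)
  · rintro h _ ⟨⟩
    exact h

theorem solves_weigh {N : ℕ} {A B : Finset (Fin N)} {child : Ordering → FCTree N}
    {f c : Fin N} :
    Solves (.weigh A B child) f c ↔ ∀ b, Solves (child (weighOutcome f c b A B)) f c := by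
  constructor
  · exact fun h b S hS => h S (.weigh A B child b S hS)
  · rintro h _ ⟨⟩
    exact h _ _ ‹_›

theorem weighOutcome_false {N : ℕ} (f c : Fin N) (A B : Finset (Fin N)) :
    weighOutcome f c false A B = weighOutcome f f false A B := by
  simp [weighOutcome, coinWeight]

theorem weighOutcome_true_comm {N : ℕ} (f c : Fin N) (A B : Finset (Fin N)) :
    weighOutcome f c true A B = weighOutcome c f true A B := by
  have h : coinWeight f c true = coinWeight c f true := by
    funext x
    by_cases h₁ : x = f <;> by_cases h₂ : x = c <;> simp [coinWeight, h₁, h₂]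
  simp [weighOutcome, h]

/-- The position of a coin in a weighing: `0` on the left pan, `2` on the right pan,
`1` outside. -/
def position {N : ℕ} (A B : Finset (Fin N)) (x : Fin N) : ℕ :=
  if x ∈ A then 0 else if x ∈ B then 2 else 1

theorem weighOutcome_eq_compare {N : ℕ} {A B : Finset (Fin N)} (hAB : Disjoint A B)
    {f c : Fin N} (b : Bool) (hfc : f ≠ c ∨ b = false) :
    weighOutcome f c b A B =
      compare (N + position A B f + b.toNat * position A B c)
        (∑ x, position A B x + 1 + b.toNat) := by
  have key : ∑ x ∈ A, coinWeight f c b x + (∑ x, position A B x + 1 + b.toNat) =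
      ∑ x ∈ B, coinWeight f c b x + (N + position A B f + b.toNat * position A B c) := by
    have h : ∑ x, ((if x ∈ A then coinWeight f c b x else 0) + (position A B x +
          (if x = f then 1 else 0) + (if x = c then b.toNat else 0))) =
        ∑ x, ((if x ∈ B then coinWeight f c b x else 0) + (1 +
          (if x = f then position A B x else 0) +
          (if x = c then b.toNat * position A B x else 0))) := by
      refine Finset.sum_congr rfl fun x _ => ?_
      have hx : ¬ (x ∈ A ∧ x ∈ B) := fun h => Finset.disjoint_left.1 hAB h.1 h.2
      have hfx : ¬ (x = f ∧ x = c) ∨ b = false := by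
        rcases hfc with h | h
        · exact .inl fun h' => h (h'.1.symm.trans h'.2)
        · exact .inr h
      unfold coinWeight position
      cases b <;> by_cases h₁ : x ∈ A <;> by_cases h₂ : x ∈ B <;> by_cases h₃ : x = f <;>
        by_cases h₄ : x = c <;> simp_all
    simpa [Finset.sum_add_distrib, Finset.sum_ite_mem] using h
  unfold weighOutcome
  rcases lt_trichotomy (∑ x ∈ A, coinWeight f c b x) (∑ x ∈ B, coinWeight f c b x)
    with h | h | h
  · rw [compare_lt_iff_lt.2 h, eq_comm, compare_lt_iff_lt]; omega
  · rw [compare_eq_iff_eq.2 h, eq_comm, compare_eq_iff_eq]; omega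
  · rw [compare_gt_iff_gt.2 h, eq_comm, compare_gt_iff_gt]; omega

theorem card_eq_card_outcome {α : Type*} (s : Finset α) (g : α → Ordering) :
    s.card = (s.filter (g · = .lt)).card + (s.filter (g · = .eq)).card +
      (s.filter (g · = .gt)).card := by
  classical
  rw [Finset.card_eq_sum_ones]
  simp only [Finset.card_filter, ← Finset.sum_add_distrib]
  refine Finset.sum_congr rfl fun x _ => ?_
  cases g x <;> rfl

/-- The counting bound: `E` consists of ordered pairs of coins that may be fake and chameleon in
either order, and `X` consists of further coins that may be fake.  Every output holds two
elements of `E` or two elements of `X` at most. -/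
theorem card_add_card_le {ι : Type*} [DecidableEq ι] {N : ℕ} {σ : ι → Fin N}
    (hσ : σ.Injective) (t : FCTree N) :
    ∀ (w : ℕ) (E : Finset (ι × ι)) (X : Finset ι), t.depth ≤ w →
      (∀ p ∈ E, p.1 ≠ p.2 ∧ p.swap ∈ E ∧ Solves t (σ p.1) (σ p.2)) →
      (∀ x ∈ X, (∃ c, Solves t (σ x) c) ∧ ∀ c, (x, c) ∉ E) →
      E.card + X.card ≤ 2 * 3 ^ w := by
  induction t with
  | output S =>
    intro w E X _ hE hX
    simp only [solves_output] at hE hX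
    have hw : 1 ≤ 3 ^ w := Nat.one_le_pow _ _ (by norm_num)
    rcases E.eq_empty_or_nonempty with rfl | ⟨⟨i, j⟩, hij⟩
    · rcases X.eq_empty_or_nonempty with rfl | ⟨x, hx⟩
      · simp
      · have h₁ : X.card ≤ S.card :=
          Finset.card_le_card_of_injOn σ (fun y hy => (hX y hy).1.elim fun _ h => h.2) hσ.injOn
        obtain ⟨_, h₂, -⟩ := (hX x hx).1
        rw [Finset.card_empty]
        omega
    · obtain ⟨hne, hji, hcard, hi⟩ := hE _ hij
      have hj := (hE _ hji).2.2.2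
      simp only [Prod.swap] at hne hji hi hj
      have hS : ({σ i, σ j} : Finset (Fin N)) = S := by
        apply Finset.eq_of_subset_of_card_le
        · intro x
          simp only [Finset.mem_insert, Finset.mem_singleton]
          rintro (rfl | rfl) <;> assumption
        · rwa [Finset.card_pair (hσ.ne hne)]
      have hmem : ∀ x, σ x ∈ S → x = i ∨ x = j := by
        intro x
        rw [← hS]
        simp [hσ.eq_iff]
      have hEsub : E ⊆ {(i, j), (j, i)} := by
        rintro ⟨a, b⟩ hab
        obtain ⟨h₁, h₂, -, h₃⟩ := hE _ hab
        have h₄ := (hE _ h₂).2.2.2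
        have ha := hmem a h₃
        have hb := hmem b h₄
        simp only [Finset.mem_insert, Finset.mem_singleton, Prod.mk.injEq]
        simp only at h₁
        grind
      have hXe : X = ∅ := by
        refine Finset.eq_empty_of_forall_notMem fun x hx => ?_
        obtain ⟨⟨_, _, hx₁⟩, hx₂⟩ := hX x hx
        rcases hmem x hx₁ with rfl | rfl
        · exact hx₂ _ hij
        · exact hx₂ _ hji
      have h₁ := Finset.card_le_card hEsub
      have h₂ : ({(i, j), (j, i)} : Finset (ι × ι)).card ≤ 2 := Finset.card_le_two
      simp [hXe]
      omega
  | weigh A B child ih =>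
    intro w E X hd hE hX
    simp only [FCTree.depth] at hd
    obtain ⟨w, rfl⟩ : ∃ w', w = w' + 1 := ⟨w - 1, by omega⟩
    simp only [solves_weigh] at hE hX
    have hchild (o : Ordering) :
        (E.filter (fun p => weighOutcome (σ p.1) (σ p.2) true A B = o)).card +
          (X.filter (fun x => weighOutcome (σ x) (σ x) false A B = o)).card ≤ 2 * 3 ^ w := by
      refine ih o w _ _ (by cases o <;> omega) ?_ ?_
      · intro p hp
        rw [Finset.mem_filter] at hp ⊢
        obtain ⟨h₁, h₂, h₃⟩ := hE p hp.1
        refine ⟨h₁, ⟨h₂, ?_⟩, hp.2 ▸ h₃ true⟩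
        rw [← hp.2]
        exact weighOutcome_true_comm _ _ _ _
      · intro x hx
        rw [Finset.mem_filter] at hx
        obtain ⟨⟨c, h₁⟩, h₂⟩ := hX x hx.1
        refine ⟨⟨c, ?_⟩, fun c hc => h₂ c (Finset.mem_filter.1 hc).1⟩
        have := h₁ false
        rwa [weighOutcome_false, hx.2] at this
    have hl := hchild .lt
    have he := hchild .eq
    have hg := hchild .gt
    rw [card_eq_card_outcome E (fun p => weighOutcome (σ p.1) (σ p.2) true A B),
      card_eq_card_outcome X (fun x => weighOutcome (σ x) (σ x) false A B), pow_succ]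
    omega

theorem compare_eq_lt_eq_gt {m n : ℕ} {o : Ordering} (h : compare m n = o) :
    (o = .lt → m < n) ∧ (o = .eq → m = n) ∧ (o = .gt → n < m) := by
  refine ⟨?_, ?_, ?_⟩ <;> rintro rfl
  · exact compare_lt_iff_lt.1 h
  · exact compare_eq_iff_eq.1 h
  · exact compare_gt_iff_gt.1 h

theorem position_le_two {N : ℕ} (A B : Finset (Fin N)) (x : Fin N) : position A B x ≤ 2 := by
  unfold position
  split_ifs <;> omega

/-- If each outcome of a weighing can be caused by a single fake coin, then for every fake coin
the chameleon can cause two different outcomes. -/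
theorem exists_weighOutcome_ne {N : ℕ} {A B : Finset (Fin N)} (hAB : Disjoint A B)
    (hall : ∀ o, ∃ x, weighOutcome x x false A B = o) (u : Fin N) (o : Ordering) :
    ∃ c b, u ≠ c ∧ weighOutcome u c b A B ≠ o := by
  by_contra! hcon
  have hsingle (x : Fin N) := weighOutcome_eq_compare hAB (f := x) (c := x) false (.inr rfl)
  obtain ⟨l, hl⟩ := hall .lt
  obtain ⟨e, he⟩ := hall .eq
  obtain ⟨g, hg⟩ := hall .gt
  rw [hsingle] at hl he hg
  have hl := (compare_eq_lt_eq_gt hl).1 rfl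
  have he := (compare_eq_lt_eq_gt he).2.1 rfl
  have hg := (compare_eq_lt_eq_gt hg).2.2 rfl
  have := position_le_two A B l
  have := position_le_two A B e
  have := position_le_two A B g
  have hu := position_le_two A B u
  simp only [Bool.toNat_false, zero_mul, add_zero] at hl he hg
  have hne {x y : Fin N} (h : position A B x ≠ position A B y) : x ≠ y := by
    rintro rfl; exact h rfl
  have huo : ∃ c, u ≠ c := by
    by_cases h : u = l
    · exact ⟨g, hne (by rw [h]; omega)⟩
    · exact ⟨l, h⟩
  obtain ⟨c, hc⟩ := huo
  have h₀ := hcon c false hc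
  rw [weighOutcome_eq_compare hAB _ (.inr rfl)] at h₀
  have h₀ := compare_eq_lt_eq_gt h₀
  simp only [Bool.toNat_false, zero_mul, add_zero] at h₀
  have hpart (y : Fin N) (h : position A B u ≠ position A B y) :=
    compare_eq_lt_eq_gt ((weighOutcome_eq_compare hAB true (.inl (hne h))).symm.trans
      (hcon y true (hne h)))
  simp only [Bool.toNat_true, one_mul] at hpart
  have hgl := hpart g
  have hll := hpart l
  cases o <;> simp at h₀ hgl hll <;> omega

/-- A sharper counting bound for a single weighing: if at least five coins may be fake, then a
coin `u` that may be fake with every other coin as chameleon needs a place in two outputs. -/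
theorem card_add_card_lt_six {ι : Type*} [DecidableEq ι] {N : ℕ} {σ : ι → Fin N}
    (hσ : σ.Injective) {t : FCTree N} (hwf : t.WF) (hd : t.depth ≤ 1)
    {E : Finset (ι × ι)} {X F : Finset ι}
    (hE : ∀ p ∈ E, p.1 ≠ p.2 ∧ p.swap ∈ E ∧ Solves t (σ p.1) (σ p.2))
    (hX : ∀ x ∈ X, (∃ c, Solves t (σ x) c) ∧ ∀ c, (x, c) ∉ E)
    (hF : ∀ x ∈ F, ∃ c, Solves t (σ x) c) (hF5 : 5 ≤ F.card)
    {u : ι} (hu : ∀ c, σ u ≠ c → Solves t (σ u) c)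
    (hdeg : ∀ i j, (u, i) ∈ E → (u, j) ∈ E → i = j) :
    E.card + X.card < 6 := by
  cases t with
  | output S =>
    have := card_add_card_le hσ (.output S) 0 ∅ F le_rfl (by simp) (by simpa using hF)
    simp at this
    omega
  | weigh A B child =>
    simp only [FCTree.depth] at hd
    have hd₀ (o) : (child o).depth ≤ 0 := by cases o <;> omega
    simp only [solves_weigh] at hE hX hF hu
    have hsolves {x : ι} {o : Ordering} (h : weighOutcome (σ x) (σ x) false A B = o)
        (hx : ∃ c, ∀ b, Solves (child (weighOutcome (σ x) c b A B)) (σ x) c) :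
        ∃ c, Solves (child o) (σ x) c := by
      obtain ⟨c, hc⟩ := hx
      have := hc false
      rw [weighOutcome_false, h] at this
      exact ⟨c, this⟩
    set E' : Ordering → Finset (ι × ι) := fun o =>
      E.filter (fun p => weighOutcome (σ p.1) (σ p.2) true A B = o) with hE'
    set X' : Ordering → Finset ι := fun o =>
      X.filter (fun x => weighOutcome (σ x) (σ x) false A B = o) with hX'
    have hE₁ (o : Ordering) : ∀ p ∈ E' o,
        p.1 ≠ p.2 ∧ p.swap ∈ E' o ∧ Solves (child o) (σ p.1) (σ p.2) := by
      intro p hp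
      rw [Finset.mem_filter] at hp ⊢
      obtain ⟨h₁, h₂, h₃⟩ := hE p hp.1
      refine ⟨h₁, ⟨h₂, ?_⟩, hp.2 ▸ h₃ true⟩
      rw [← hp.2]
      exact weighOutcome_true_comm _ _ _ _
    have hX₁ (o : Ordering) : ∀ x ∈ X' o,
        (∃ c, Solves (child o) (σ x) c) ∧ ∀ c, (x, c) ∉ E' o := by
      intro x hx
      rw [Finset.mem_filter] at hx
      exact ⟨hsolves hx.2 (hX x hx.1).1,
        fun c hc => (hX x hx.1).2 c (Finset.mem_filter.1 hc).1⟩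
    have hchild (o : Ordering) : (E' o).card + (X' o).card ≤ 2 := by
      simpa using card_add_card_le hσ (child o) 0 _ _ (hd₀ o) (hE₁ o) (hX₁ o)
    have hall (o : Ordering) : ∃ x, weighOutcome x x false A B = o := by
      have hle (o : Ordering) :
          (F.filter (fun x => weighOutcome (σ x) (σ x) false A B = o)).card ≤ 2 := by
        have := card_add_card_le hσ (child o) 0 ∅
          (F.filter (fun x => weighOutcome (σ x) (σ x) false A B = o)) (hd₀ o) (by simp) (by
            intro x hx
            rw [Finset.mem_filter] at hx
            exact ⟨hsolves hx.2 (hF x hx.1), by simp⟩)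
        simpa using this
      by_contra! hcon
      have h₀ : (F.filter (fun x => weighOutcome (σ x) (σ x) false A B = o)).card = 0 := by
        simp [hcon]
      have hsum := card_eq_card_outcome F (fun x => weighOutcome (σ x) (σ x) false A B)
      have hl := hle .lt
      have he := hle .eq
      have hg := hle .gt
      cases o <;> omega
    obtain ⟨o₀, ho₁, ho₂⟩ : ∃ o₀, (∀ i, (u, i) ∈ E → weighOutcome (σ u) (σ i) true A B = o₀) ∧
        (u ∈ X → weighOutcome (σ u) (σ u) false A B = o₀) := by
      by_cases h : ∃ i, (u, i) ∈ E
      · obtain ⟨i, hi⟩ := h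
        exact ⟨weighOutcome (σ u) (σ i) true A B, fun j hj => by rw [hdeg j i hj hi],
          fun hux => absurd hi ((hX u hux).2 i)⟩
      · exact ⟨_, fun i hi => absurd ⟨i, hi⟩ h, fun _ => rfl⟩
    obtain ⟨c, b, huc, hne⟩ := exists_weighOutcome_ne hwf.1 hall (σ u) o₀
    set o := weighOutcome (σ u) c b A B with ho
    have huX : u ∉ X' o := fun h => by
      rw [Finset.mem_filter] at h
      exact hne (h.2.symm.trans (ho₂ h.1))
    have hextra : (E' o).card + (insert u (X' o)).card ≤ 2 := by
      have := card_add_card_le hσ (child o) 0 (E' o) (insert u (X' o)) (hd₀ o) (hE₁ o) (by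
        intro x hx
        rcases Finset.mem_insert.1 hx with rfl | hx
        · refine ⟨⟨c, hu c huc b⟩, fun i hi => ?_⟩
          rw [Finset.mem_filter] at hi
          exact hne (hi.2.symm.trans (ho₁ i hi.1))
        · exact hX₁ o x hx)
      simpa using this
    rw [Finset.card_insert_of_notMem huX] at hextra
    have hl := hchild .lt
    have he := hchild .eq
    have hg := hchild .gt
    have hsE : E.card = (E' .lt).card + (E' .eq).card + (E' .gt).card :=
      card_eq_card_outcome E _
    have hsX : X.card = (X' .lt).card + (X' .eq).card + (X' .gt).card :=
      card_eq_card_outcome X _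
    generalize o = o' at hextra
    cases o' <;> omega

/-- The strategy of three weighings for six coins. -/
def sixCoinStrategy : FCTree 6 :=
  .weigh {0, 1} {4, 5} fun
  | .lt => .weigh {0} {5} fun
      | .lt => .weigh {1} {3} fun
          | .lt => .output {0, 1}
          | .eq => .output {0, 2}
          | .gt => .output {0, 3}
      | .eq => .weigh {2} {3} fun
          | .lt => .output {1, 2}
          | .eq => .output {0, 1}
          | .gt => .output {1, 3}
      | .gt => .output {1}
  | .eq => .weigh {0} {1} fun
      | .lt => .weigh {1, 4} {2, 3} fun
          | .lt => .output {0, 4}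
          | .eq => .output {0, 5}
          | .gt => .output {2, 3}
      | .eq => .weigh {2, 3} {4, 5} fun
          | .lt => .output {2, 3}
          | .eq => .output {2, 3}
          | .gt => .output {4, 5}
      | .gt => .weigh {0, 4} {2, 3} fun
          | .lt => .output {1, 4}
          | .eq => .output {1, 5}
          | .gt => .output {2, 3}
  | .gt => .weigh {0} {5} fun
      | .lt => .output {4}
      | .eq => .weigh {2} {3} fun
          | .lt => .output {2, 4}
          | .eq => .output {4, 5}
          | .gt => .output {3, 4}
      | .gt => .weigh {2} {4} fun
          | .lt => .output {2, 5}
          | .eq => .output {3, 5}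
          | .gt => .output {4, 5}

/-- A Boolean test for `Solves`. -/
def solvesBool {N : ℕ} (f c : Fin N) : FCTree N → Bool
  | .output S => decide (S.card ≤ 2 ∧ f ∈ S)
  | .weigh A B child =>
      solvesBool f c (child (weighOutcome f c false A B)) &&
        solvesBool f c (child (weighOutcome f c true A B))

theorem solves_of_solvesBool {N : ℕ} {f c : Fin N} (t : FCTree N) (h : solvesBool f c t = true) :
    Solves t f c := by
  induction t with
  | output S => exact solves_output.2 (of_decide_eq_true h)
  | weigh A B child ih =>
    rw [solvesBool, Bool.and_eq_true] at h
    rw [solves_weigh]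
    rintro (_ | _)
    · exact ih _ h.1
    · exact ih _ h.2

theorem wf_sixCoinStrategy : sixCoinStrategy.WF := by
  refine ⟨by decide, fun o => ?_⟩
  rcases o with _ | _ | _ <;> refine ⟨by decide, fun o => ?_⟩ <;>
    rcases o with _ | _ | _ <;> first
      | trivial
      | (refine ⟨by decide, fun o => ?_⟩; rcases o with _ | _ | _ <;> trivial)

theorem fcAlgorithm_six_three : FCAlgorithm 6 3 := by
  refine ⟨sixCoinStrategy, wf_sixCoinStrategy, by decide, ?_⟩
  have h : ∀ f c : Fin 6, f ≠ c → solvesBool f c sixCoinStrategy = true := by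
    decide +kernel
  exact fun f c hfc => solves_of_solvesBool _ (h f c hfc)

theorem not_fcAlgorithm_of_seven_lt {N : ℕ} (hN : 7 < N) : ¬ FCAlgorithm N 3 := by
  rintro ⟨t, -, hd, ht⟩
  have := card_add_card_le (σ := id) Function.injective_id t 3 Finset.univ.offDiag ∅ hd
    (by
      intro p hp
      rw [Finset.mem_offDiag] at hp
      refine ⟨hp.2.2, ?_, ht _ _ hp.2.2⟩
      simpa [eq_comm] using hp.2.2)
    (by simp)
  rw [Finset.offDiag_card, Finset.card_univ, Fintype.card_fin, ← Nat.sub_one_mul] at this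
  obtain ⟨k, rfl⟩ := Nat.exists_eq_add_of_lt hN
  simp at this
  nlinarith

/-- The sum of the values of a function on seven coins. -/
def total (g : Fin 7 → ℕ) : ℕ := g 0 + g 1 + g 2 + g 3 + g 4 + g 5 + g 6

theorem sum_eq_total (g : Fin 7 → ℕ) : ∑ i, g i = total g := Fin.sum_univ_seven g

theorem card_filter_eq_total (p : Fin 7 → Bool) :
    (Finset.univ.filter (fun i => p i = true)).card = total fun i => (p i).toNat := by
  rw [← sum_eq_total, Finset.card_filter]
  exact Finset.sum_congr rfl fun i _ => by cases p i <;> rfl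

namespace CoinState

/-! A state of knowledge about seven coins is a matrix `M` such that `M i j` holds if coin `i` may
be fake and coin `j` the chameleon. -/

/-- Comparison of two numbers with a given outcome. -/
def comparesTo : Ordering → ℕ → ℕ → Bool
  | .lt, m, n => Nat.blt m n
  | .eq, m, n => Nat.beq m n
  | .gt, m, n => Nat.blt n m

/-- The state after a weighing with outcome `o`, where `w` lists the positions of the coins and
`s` is the sum of `w`. -/
def step (w : Fin 7 → ℕ) (s : ℕ) (o : Ordering) (M : Fin 7 → Fin 7 → Bool) (i j : Fin 7) : Bool :=
  M i j && (comparesTo o (7 + w i) (s + 1) || comparesTo o (7 + w i + w j) (s + 2))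

/-- Coins `i` and `j` may be fake and chameleon in either order. -/
def edge (M : Fin 7 → Fin 7 → Bool) (i j : Fin 7) : Bool := M i j && M j i

/-- The degree of `i` in the graph of edges. -/
def deg (M : Fin 7 → Fin 7 → Bool) (i : Fin 7) : ℕ := total fun j => (edge M i j).toNat

/-- Coin `i` may be fake. -/
def candidate (M : Fin 7 → Fin 7 → Bool) (i : Fin 7) : Bool :=
  M i 0 || M i 1 || M i 2 || M i 3 || M i 4 || M i 5 || M i 6

/-- Coin `i` may be fake but lies on no edge. -/
def isolated (M : Fin 7 → Fin 7 → Bool) (i : Fin 7) : Bool :=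
  candidate M i && Nat.beq (deg M i) 0

/-- A lower bound for the total size of all outputs. -/
def slots (M : Fin 7 → Fin 7 → Bool) : ℕ :=
  total (deg M) + total fun i => (isolated M i).toNat

/-- Coin `i` may be fake with every other coin as chameleon, and has degree at most one. -/
def demanding (M : Fin 7 → Fin 7 → Bool) (i : Fin 7) : Bool :=
  Nat.beq (total fun j => (M i j).toNat) 6 && Nat.ble (deg M i) 1

/-- A state that cannot be resolved in one weighing. -/
def hopeless (M : Fin 7 → Fin 7 → Bool) : Bool :=
  Nat.blt 6 (slots M) ||
    Nat.ble 6 (slots M) && Nat.ble 5 (total fun i => (candidate M i).toNat) &&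
      (demanding M 0 || demanding M 1 || demanding M 2 || demanding M 3 || demanding M 4 ||
        demanding M 5 || demanding M 6)

/-- The state before the first weighing. -/
def initial (i j : Fin 7) : Bool := !Nat.beq i.val j.val

/-- The state after a balanced weighing of two coins against two coins. -/
def balanced (i j : Fin 7) : Bool :=
  Nat.testBit 13327266672736 (7 * i.val + j.val)

end CoinState

open CoinState

theorem balanced_eq_step :
    ∀ i j, step ![0, 0, 1, 1, 1, 2, 2] 7 .eq initial i j = balanced i j := by
  decide +kernel

set_option synthInstance.maxHeartbeats 200000 in
theorem exists_slots_step_initial : ∀ a b c d e f g : Fin 3,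
    (a ≤ b ∧ b ≤ c ∧ c ≤ d ∧ d ≤ e ∧ e ≤ f ∧ f ≤ g) →
    ![a, b, c, d, e, f, g] = ![0, 0, 1, 1, 1, 2, 2] ∨
      ∃ o : Ordering, 18 < slots
        (step ![a.val, b.val, c.val, d.val, e.val, f.val, g.val]
          (a.val + b.val + c.val + d.val + e.val + f.val + g.val) o initial) := by
  decide +kernel

theorem exists_hopeless_step_balanced : ∀ a b c d e f g : Fin 3,
    ∃ o : Ordering, hopeless
        (step ![a.val, b.val, c.val, d.val, e.val, f.val, g.val]
          (a.val + b.val + c.val + d.val + e.val + f.val + g.val) o balanced) = true := by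
  decide +kernel

/-- Strategy `t` copes with every case that is possible in state `M`, where `σ` names the coins. -/
def Resolves (t : FCTree 7) (σ : Equiv.Perm (Fin 7)) (M : Fin 7 → Fin 7 → Bool) : Prop :=
  ∀ i j, M i j = true → i ≠ j ∧ Solves t (σ i) (σ j)

theorem comparesTo_iff {o : Ordering} {m n : ℕ} :
    comparesTo o m n = true ↔ compare m n = o := by
  cases o
  · simp [comparesTo, compare_lt_iff_lt]
  · simp [comparesTo]
  · simp [comparesTo, compare_gt_iff_gt]

theorem Resolves.step {A B : Finset (Fin 7)} {child : Ordering → FCTree 7}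
    {σ : Equiv.Perm (Fin 7)} {M : Fin 7 → Fin 7 → Bool}
    (h : Resolves (.weigh A B child) σ M) (hAB : Disjoint A B) (o : Ordering) :
    Resolves (child o) σ
      (step (fun i => position A B (σ i)) (total fun i => position A B (σ i)) o M) := by
  intro i j hij
  simp only [CoinState.step, Bool.and_eq_true, Bool.or_eq_true, comparesTo_iff] at hij
  obtain ⟨hne, hs⟩ := h i j hij.1
  rw [solves_weigh] at hs
  have htotal : ∑ x, position A B x = total fun i => position A B (σ i) := by
    rw [← sum_eq_total, Equiv.sum_comp σ (position A B)]
  have hout (b : Bool) := weighOutcome_eq_compare hAB b (.inl (σ.injective.ne hne))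
  refine ⟨hne, ?_⟩
  rcases hij.2 with ho | ho
  · have := hs false
    rwa [hout, htotal, Bool.toNat_false, zero_mul, add_zero, add_zero, ho] at this
  · have := hs true
    rwa [hout, htotal, Bool.toNat_true, one_mul, ho] at this

theorem candidate_iff {M : Fin 7 → Fin 7 → Bool} {i : Fin 7} :
    candidate M i = true ↔ ∃ j, M i j = true := by
  simp [candidate, Fin.exists_fin_succ, or_assoc]

/-- The set of edges of a state. -/
def edges (M : Fin 7 → Fin 7 → Bool) : Finset (Fin 7 × Fin 7) :=
  Finset.univ.filter fun p => edge M p.1 p.2 = true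

theorem card_edges (M : Fin 7 → Fin 7 → Bool) : (edges M).card = total (deg M) := by
  rw [edges, Finset.card_filter, Fintype.sum_prod_type, ← sum_eq_total]
  refine Finset.sum_congr rfl fun i _ => ?_
  rw [deg, ← card_filter_eq_total, Finset.card_filter]

theorem Resolves.edges {t : FCTree 7} {σ : Equiv.Perm (Fin 7)} {M : Fin 7 → Fin 7 → Bool}
    (h : Resolves t σ M) :
    ∀ p ∈ edges M, p.1 ≠ p.2 ∧ p.swap ∈ edges M ∧ Solves t (σ p.1) (σ p.2) := by
  intro p hp
  simp only [_root_.edges, edge, Finset.mem_filter, Finset.mem_univ, true_and, Bool.and_eq_true,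
    Prod.fst_swap, Prod.snd_swap] at hp ⊢
  exact ⟨(h _ _ hp.1).1, hp.symm, (h _ _ hp.1).2⟩

theorem Resolves.candidate {t : FCTree 7} {σ : Equiv.Perm (Fin 7)} {M : Fin 7 → Fin 7 → Bool}
    (h : Resolves t σ M) {i : Fin 7} (hi : candidate M i = true) : ∃ c, Solves t (σ i) c := by
  obtain ⟨j, hj⟩ := candidate_iff.1 hi
  exact ⟨σ j, (h i j hj).2⟩

theorem deg_eq_card (M : Fin 7 → Fin 7 → Bool) (i : Fin 7) :
    deg M i = (Finset.univ.filter fun j => edge M i j = true).card :=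
  (card_filter_eq_total _).symm

theorem Resolves.isolated {t : FCTree 7} {σ : Equiv.Perm (Fin 7)} {M : Fin 7 → Fin 7 → Bool}
    (h : Resolves t σ M) :
    ∀ x ∈ Finset.univ.filter (fun i => isolated M i = true),
      (∃ c, Solves t (σ x) c) ∧ ∀ c, (x, c) ∉ _root_.edges M := by
  intro x hx
  simp only [CoinState.isolated, Finset.mem_filter, Finset.mem_univ, true_and,
    Bool.and_eq_true, Nat.beq_eq, deg_eq_card, Finset.card_eq_zero] at hx
  refine ⟨h.candidate hx.1, fun c hc => ?_⟩
  have : c ∈ Finset.univ.filter (fun j => edge M x j = true) := by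
    simpa [_root_.edges] using hc
  simp [hx.2] at this

theorem Resolves.slots_le {t : FCTree 7} {σ : Equiv.Perm (Fin 7)} {M : Fin 7 → Fin 7 → Bool}
    (h : Resolves t σ M) {w : ℕ} (hd : t.depth ≤ w) : slots M ≤ 2 * 3 ^ w := by
  rw [slots, ← card_edges, ← card_filter_eq_total]
  exact card_add_card_le σ.injective t w _ _ hd h.edges h.isolated

theorem Resolves.not_demanding {t : FCTree 7} {σ : Equiv.Perm (Fin 7)}
    {M : Fin 7 → Fin 7 → Bool} (h : Resolves t σ M) (hwf : t.WF) (hd : t.depth ≤ 1)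
    (h₅ : 5 ≤ total fun i => (CoinState.candidate M i).toNat) (h₆ : 6 ≤ slots M) (u : Fin 7) :
    demanding M u = false := by
  by_contra hu
  rw [Bool.not_eq_false, demanding, Bool.and_eq_true, Nat.beq_eq, Nat.ble_eq,
    deg_eq_card, ← card_filter_eq_total, Finset.card_le_one] at hu
  rw [slots, ← card_edges, ← card_filter_eq_total] at h₆
  rw [← card_filter_eq_total] at h₅
  refine absurd (card_add_card_lt_six σ.injective hwf hd h.edges h.isolated
    (fun x hx => h.candidate (Finset.mem_filter.1 hx).2) h₅ (u := u) ?_ ?_) (by omega)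
  · intro c hc
    obtain ⟨j, rfl⟩ := σ.surjective c
    have hsub : Finset.univ.filter (fun j => M u j = true) = Finset.univ.erase u := by
      apply Finset.eq_of_subset_of_card_le
      · intro k hk
        simpa [eq_comm] using (h u k (Finset.mem_filter.1 hk).2).1
      · simp [hu.1]
    have hj : j ∈ Finset.univ.erase u := by simpa [eq_comm] using hc
    rw [← hsub] at hj
    exact (h u j (Finset.mem_filter.1 hj).2).2
  · intro i j hi hj
    exact hu.2 i (by simpa [_root_.edges] using hi) j (by simpa [_root_.edges] using hj)

theorem Resolves.not_hopeless {t : FCTree 7} {σ : Equiv.Perm (Fin 7)} {M : Fin 7 → Fin 7 → Bool}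
    (h : Resolves t σ M) (hwf : t.WF) (hd : t.depth ≤ 1) : hopeless M = false := by
  have hle := h.slots_le hd
  by_contra hM
  simp only [hopeless, Bool.not_eq_false, Bool.or_eq_true, Bool.and_eq_true, Nat.blt_eq,
    Nat.ble_eq] at hM
  rcases hM with hM | ⟨⟨h₆, h₅⟩, hu⟩
  · omega
  · simp [h.not_demanding hwf hd h₅ h₆] at hu

theorem exists_eq_cons {w : Fin 7 → ℕ} (hw : ∀ i, w i ≤ 2) : ∃ a b c d e f g : Fin 3,
    w = ![a.val, b.val, c.val, d.val, e.val, f.val, g.val] ∧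
      total w = a.val + b.val + c.val + d.val + e.val + f.val + g.val := by
  have h (i : Fin 7) : w i < 3 := Nat.lt_succ_of_le (hw i)
  refine ⟨⟨_, h 0⟩, ⟨_, h 1⟩, ⟨_, h 2⟩, ⟨_, h 3⟩, ⟨_, h 4⟩, ⟨_, h 5⟩, ⟨_, h 6⟩, ?_, rfl⟩
  funext i
  fin_cases i <;> rfl

theorem not_resolves_balanced {t : FCTree 7} (hwf : t.WF) (hd : t.depth ≤ 2)
    (σ : Equiv.Perm (Fin 7)) : ¬ Resolves t σ balanced := by
  intro h
  cases t with
  | output S =>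
    exact absurd (h.slots_le (w := 0) le_rfl) (by decide +kernel)
  | weigh A B child =>
    simp only [FCTree.depth] at hd
    obtain ⟨a, b, c, d, e, f, g, hw, hs⟩ :=
      exists_eq_cons fun i => position_le_two A B (σ i)
    obtain ⟨o, ho⟩ := exists_hopeless_step_balanced a b c d e f g
    have hstep := h.step hwf.1 o
    rw [hw, ← hw, hs, hw] at hstep
    have := hstep.not_hopeless (hwf.2 o) (by cases o <;> omega)
    simp [this] at ho

theorem not_fcAlgorithm_seven_three : ¬ FCAlgorithm 7 3 := by
  rintro ⟨t, hwf, hd, ht⟩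
  have hinit (σ : Equiv.Perm (Fin 7)) : Resolves t σ initial := by
    intro i j hij
    have hne : i ≠ j := by
      rintro rfl
      simp [initial] at hij
    exact ⟨hne, ht _ _ (σ.injective.ne hne)⟩
  cases t with
  | output S =>
    exact absurd ((hinit 1).slots_le (w := 0) le_rfl) (by decide +kernel)
  | weigh A B child =>
    simp only [FCTree.depth] at hd
    have hmono := Tuple.monotone_sort (position A B)
    set σ := Tuple.sort (position A B)
    obtain ⟨a, b, c, d, e, f, g, hw, hs⟩ :=
      exists_eq_cons fun i => position_le_two A B (σ i)
    have hstep (o : Ordering) := (hinit σ).step hwf.1 o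
    rw [hs, hw] at hstep
    have hdo (o : Ordering) : (child o).depth ≤ 2 := by cases o <;> omega
    have hmono' : Monotone ![a.val, b.val, c.val, d.val, e.val, f.val, g.val] := hw ▸ hmono
    rcases exists_slots_step_initial a b c d e f g
      ⟨hmono' (show (0 : Fin 7) ≤ 1 by decide), hmono' (show (1 : Fin 7) ≤ 2 by decide),
        hmono' (show (2 : Fin 7) ≤ 3 by decide), hmono' (show (3 : Fin 7) ≤ 4 by decide),
        hmono' (show (4 : Fin 7) ≤ 5 by decide), hmono' (show (5 : Fin 7) ≤ 6 by decide)⟩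
      with heq | ⟨o, ho⟩
    · simp only [Matrix.vecCons_inj] at heq
      obtain ⟨rfl, rfl, rfl, rfl, rfl, rfl, rfl, -⟩ := heq
      refine not_resolves_balanced (hwf.2 .eq) (hdo .eq) σ fun i j hij => ?_
      rw [← balanced_eq_step] at hij
      exact hstep .eq i j hij
    · have := (hstep o).slots_le (hdo o)
      omega

/-- N(3) = 6: there is an FC-algorithm in 3 weighings for 6 coins, and no
FC-algorithm in 3 weighings exists for more than 6 coins. -/
theorem fc_N_three_eq_six :
    FCAlgorithm 6 3 ∧ ∀ N : ℕ, 6 < N → ¬ FCAlgorithm N 3 := by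
  refine ⟨fcAlgorithm_six_three, fun N hN => ?_⟩
  rcases eq_or_lt_of_le (show 7 ≤ N from hN) with rfl | h
  · exact not_fcAlgorithm_seven_three
  · exact not_fcAlgorithm_of_seven_lt h
end

section
/- N(4) = 11; that is, there is an FC-algorithm in 4 weighings for 11 coins, and no FC-algorithm in 4 weighings exists for 12 or more coins. -/
namespace Coins

/-- The pairs (fake, chameleon) still possible after a weighing with outcome `o`, where `p` records
the pan of each coin (`1` left, `-1` right, `0` off the scale) and `d` is the difference of the pan
sizes.  A diagonal pair records that a coin is still a candidate for being fake. -/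
def step (K : ℕ → ℕ → Prop) (p : ℕ → ℤ) (d : ℤ) (o : Ordering) (f c : ℕ) : Prop :=
  if f = c then (∃ c', K f c') ∧ compare d (p f) = o
  else K f c ∧ (compare d (p f) = o ∨ compare d (p f + p c) = o)

/-- `p` takes only the values `-1`, `0` and `1`. -/
def IsPos (p : ℕ → ℤ) : Prop := ∀ i, p i = -1 ∨ p i = 0 ∨ p i = 1

/-- The state `K` can be resolved in the given number of weighings, with arbitrary offsets. -/
def Solv : (ℕ → ℕ → Prop) → ℕ → Prop
  | K, 0 => ∃ S : Finset ℕ, S.card ≤ 2 ∧ ∀ f c, K f c → f ∈ S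
  | K, w + 1 => ∃ p d, IsPos p ∧ ∀ o, Solv (step K p d o) w

theorem Solv.embed {K K' : ℕ → ℕ → Prop} {w : ℕ} (φ : ℕ → ℕ) (T : Set ℕ) (hφ : Set.InjOn φ T)
    (hT : ∀ f c, K' f c → f ∈ T ∧ c ∈ T)
    (harc : ∀ f c, f ≠ c → K' f c → K (φ f) (φ c))
    (hcand : ∀ f c, K' f c → ∃ c', K (φ f) c') (h : Solv K w) : Solv K' w := by
  induction w generalizing K K' with
  | zero =>
    obtain ⟨S, hS, hK⟩ := h
    classical
    let U : Set ℕ := {f | ∃ c, K' f c}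
    have hU : Set.MapsTo φ U S := fun f ⟨c, hc⟩ => by
      obtain ⟨c', hc'⟩ := hcand f c hc
      exact hK _ _ hc'
    have hinj : Set.InjOn φ U := fun a ⟨c, hc⟩ b ⟨c', hc'⟩ hab =>
      hφ (hT _ _ hc).1 (hT _ _ hc').1 hab
    have hfin : U.Finite := Set.Finite.of_injOn hU hinj S.finite_toSet
    refine ⟨hfin.toFinset, ?_, fun f c hc => by simpa using ⟨c, hc⟩⟩
    refine le_trans (Finset.card_le_card_of_injOn φ ?_ ?_) hS
    · intro x hx; exact hU (by simpa using hx)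
    · simpa using hinj
  | succ w ih =>
    obtain ⟨p, d, hp, h⟩ := h
    refine ⟨p ∘ φ, d, fun i => hp _, fun o => ih ?_ ?_ ?_ (h o)⟩
    · intro f c hfc
      unfold step at hfc
      split_ifs at hfc with e
      · obtain ⟨⟨c', hc'⟩, -⟩ := hfc
        exact e ▸ ⟨(hT _ _ hc').1, (hT _ _ hc').1⟩
      · exact hT _ _ hfc.1
    · intro f c hne hfc
      have hfc' := hfc
      unfold step at hfc ⊢
      rw [if_neg hne] at hfc
      have := hT _ _ hfc.1
      rw [if_neg fun e => hne (hφ this.1 this.2 e)]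
      exact ⟨harc f c hne hfc.1, hfc.2⟩
    · intro f c hfc
      unfold step at hfc
      split_ifs at hfc with e
      · obtain ⟨⟨c', hc'⟩, h1⟩ := hfc
        refine ⟨φ f, ?_⟩
        unfold step
        rw [if_pos rfl]
        exact ⟨hcand _ _ hc', h1⟩
      · have := hT _ _ hfc.1
        refine ⟨φ c, ?_⟩
        unfold step
        rw [if_neg fun e' => e (hφ this.1 this.2 e')]
        exact ⟨harc f c e hfc.1, hfc.2⟩

theorem Solv.sub {K K' : ℕ → ℕ → Prop} {w : ℕ} (harc : ∀ f c, f ≠ c → K' f c → K f c)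
    (hcand : ∀ f c, K' f c → ∃ c', K f c') (h : Solv K w) : Solv K' w :=
  h.embed id Set.univ (Set.injOn_id _) (by simp) harc hcand

theorem Solv.mono {K K' : ℕ → ℕ → Prop} {w : ℕ} (hK : ∀ f c, K' f c → K f c)
    (h : Solv K w) : Solv K' w :=
  h.sub (fun f c _ => hK f c) fun f c hc => ⟨c, hK f c hc⟩

/-- Weighing nothing. -/
theorem Solv.idle {K : ℕ → ℕ → Prop} {w : ℕ} (h : Solv K w) (o : Ordering) :
    Solv (step K (fun _ => 0) 0 o) w := by
  refine h.sub (fun f c hne hfc => ?_) fun f c hfc => ?_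
  · rw [step, if_neg hne] at hfc
    exact hfc.1
  · unfold step at hfc
    split_ifs at hfc with e
    · exact hfc.1
    · exact ⟨c, hfc.1⟩

theorem Solv.succ {K : ℕ → ℕ → Prop} {w : ℕ} (h : Solv K w) : Solv K (w + 1) :=
  ⟨fun _ => 0, 0, fun _ => by simp, h.idle⟩

theorem compare_neg (a b : ℤ) : compare (-a) (-b) = (compare a b).swap := by
  rcases lt_trichotomy a b with h | h | h
  · rw [Int.compare_eq_lt.2 h, Int.compare_eq_gt.2 (by omega)]; rfl
  · rw [Int.compare_eq_eq.2 h, Int.compare_eq_eq.2 (by omega)]; rfl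
  · rw [Int.compare_eq_gt.2 h, Int.compare_eq_lt.2 (by omega)]; rfl

/-- The offset of a weighing may be taken to be `0` or `1`. -/
theorem exists_normalized {K : ℕ → ℕ → Prop} {w : ℕ} {p : ℕ → ℤ} {d : ℤ} (hp : IsPos p)
    (h : ∀ o, Solv (step K p d o) w) :
    ∃ p' d', IsPos p' ∧ (d' = 0 ∧ (p' = 0 ∨ d = 0 ∧ p' = p) ∨ d' = 1) ∧
      ∀ o, Solv (step K p' d' o) w := by
  by_cases hd : 2 ≤ d ∨ d ≤ -2
  · have hK : Solv K w := by
      obtain ⟨o, ho⟩ : ∃ o, ∀ f, compare d (p f) = o := by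
        rcases hd with hd | hd
        · exact ⟨.gt, fun f => by rw [Int.compare_eq_gt]; rcases hp f with h | h | h <;> omega⟩
        · exact ⟨.lt, fun f => by rw [Int.compare_eq_lt]; rcases hp f with h | h | h <;> omega⟩
      refine (h o).mono fun f c hfc => ?_
      unfold step
      split_ifs with e
      · exact ⟨⟨c, hfc⟩, ho f⟩
      · exact ⟨hfc, Or.inl (ho f)⟩
    exact ⟨0, 0, fun _ => by simp, Or.inl ⟨rfl, Or.inl rfl⟩, hK.idle⟩
  · by_cases h1 : d = -1
    · refine ⟨fun i => -p i, 1, fun i => by rcases hp i with h | h | h <;> simp [h], Or.inr rfl,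
        fun o => (h o.swap).mono fun f c hfc => ?_⟩
      have key : ∀ a : ℤ, compare (1 : ℤ) (-a) = o → compare d a = o.swap := fun a ha => by
        rw [← ha, ← compare_neg, h1, neg_neg]
      unfold step at hfc ⊢
      split_ifs at hfc ⊢ with e
      · exact ⟨hfc.1, key _ hfc.2⟩
      · refine ⟨hfc.1, hfc.2.imp (key _) fun h2 => key _ ?_⟩
        rw [← h2]; congr 1; ring
    · refine ⟨p, d, hp, ?_, h⟩
      by_cases h0 : d = 0
      · exact Or.inl ⟨h0, Or.inr ⟨h0, rfl⟩⟩
      · exact Or.inr (by omega)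

theorem Solv.normalize {K : ℕ → ℕ → Prop} {w : ℕ} (h : Solv K (w + 1)) :
    ∃ p d, IsPos p ∧ (d = 0 ∨ d = 1) ∧ ∀ o, Solv (step K p d o) w := by
  obtain ⟨p, d, hp, h⟩ := h
  obtain ⟨p', d', hp', hd, h'⟩ := exists_normalized hp h
  exact ⟨p', d', hp', hd.imp_left And.left, h'⟩

/-- `i` encodes the pair of coins `i / 16`, `i % 16 - 1`, or the single coin `i / 16` when
`i % 16 = 0`; it is good if the pair is possible in both orders, or if the coin is a candidate. -/
def Good (K : ℕ → ℕ → Prop) (i : ℕ) : Prop :=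
  if i % 16 = 0 then ∃ c, K (i / 16) c
  else i / 16 ≠ i % 16 - 1 ∧ K (i / 16) (i % 16 - 1) ∧ K (i % 16 - 1) (i / 16)

theorem Good.step {K : ℕ → ℕ → Prop} {i : ℕ} (h : Good K i) (p : ℕ → ℤ) (d : ℤ) :
    ∃ o, Good (step K p d o) i := by
  unfold Good at h
  split_ifs at h with e
  · refine ⟨compare d (p (i / 16)), ?_⟩
    rw [Good, if_pos e]
    exact ⟨i / 16, by rw [Coins.step, if_pos rfl]; exact ⟨h, rfl⟩⟩
  · refine ⟨compare d (p (i / 16) + p (i % 16 - 1)), ?_⟩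
    rw [Good, if_neg e]
    refine ⟨h.1, ?_, ?_⟩
    · rw [Coins.step, if_neg h.1]
      exact ⟨h.2.1, Or.inr rfl⟩
    · rw [Coins.step, if_neg (Ne.symm h.1), add_comm]
      exact ⟨h.2.2, Or.inr rfl⟩

theorem Solv.card_le {K : ℕ → ℕ → Prop} {w : ℕ} (h : Solv K w) (E : Finset ℕ)
    (hE : ∀ i ∈ E, Good K i) (hE' : ∀ i ∈ E, ∀ j ∈ E, i % 16 = 0 → i / 16 = j / 16 → i = j) :
    E.card ≤ 2 * 3 ^ w := by
  classical
  induction w generalizing K E with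
  | zero =>
    obtain ⟨S, hS, hK⟩ := h
    have hfst : ∀ i ∈ E, i / 16 ∈ S := fun i hi => by
      have := hE i hi
      unfold Good at this
      split_ifs at this
      · exact hK _ _ this.choose_spec
      · exact hK _ _ this.2.1
    have hsnd : ∀ i ∈ E, i % 16 ≠ 0 → i / 16 ≠ i % 16 - 1 ∧ i % 16 - 1 ∈ S := fun i hi h0 => by
      have := hE i hi
      rw [Good, if_neg h0] at this
      exact ⟨this.1, hK _ _ this.2.2⟩
    refine le_trans (Finset.card_le_card_of_injOn (· / 16) hfst ?_) (by simpa using hS)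
    intro i hi j hj hij
    simp only at hij
    by_cases h0 : i % 16 = 0
    · exact hE' i hi j hj h0 hij
    by_cases h0' : j % 16 = 0
    · exact (hE' j hj i hi h0' hij.symm).symm
    obtain ⟨hi1, hi2⟩ := hsnd i hi h0
    obtain ⟨hj1, hj2⟩ := hsnd j hj h0'
    by_contra hne
    have hne' : i % 16 - 1 ≠ j % 16 - 1 := by omega
    have h3 : ({i / 16, i % 16 - 1, j % 16 - 1} : Finset ℕ).card = 3 := by
      rw [Finset.card_eq_three]
      exact ⟨_, _, _, hi1, hij ▸ hj1, hne', rfl⟩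
    have : ({i / 16, i % 16 - 1, j % 16 - 1} : Finset ℕ) ⊆ S := by
      intro x hx
      simp only [Finset.mem_insert, Finset.mem_singleton] at hx
      rcases hx with rfl | rfl | rfl
      exacts [hfst i hi, hi2, hj2]
    have := Finset.card_le_card this
    omega
  | succ w ih =>
    obtain ⟨p, d, -, h⟩ := h
    have hcov : E ⊆ (Finset.univ : Finset Ordering).biUnion
        fun o => E.filter (Good (step K p d o)) := fun i hi => by
      obtain ⟨o, ho⟩ := (hE i hi).step p d
      exact Finset.mem_biUnion.2 ⟨o, Finset.mem_univ _, Finset.mem_filter.2 ⟨hi, ho⟩⟩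
    refine (Finset.card_le_card hcov).trans (Finset.card_biUnion_le_card_mul _ _ (2 * 3 ^ w) ?_
      |>.trans ?_)
    · intro o _
      refine ih (h o) _ (fun i hi => (Finset.mem_filter.1 hi).2) fun i hi j hj => ?_
      exact hE' i (Finset.mem_filter.1 hi).1 j (Finset.mem_filter.1 hj).1
    · have : (Finset.univ : Finset Ordering).card = 3 := rfl
      rw [this, pow_succ]
      omega

/-- Evaluates `x` to a numeral before calling `k`. -/
def force {α : Type} (x : ℕ) (k : ℕ → α) : α :=
  Nat.casesOn x (k 0) fun n => k (Nat.succ n)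

/-- The `n`-th bit of `m`. -/
def bit (m n : ℕ) : Bool := Nat.beq (Nat.land (Nat.shiftRight m n) 1) 1

/-- The numeral with bits `0, 16, …, 240`. -/
def col0 : ℕ := 1766874025136433896750911497805568136923323180981774075523881651146915841

/-- The bits of row `x` of a matrix with 16 columns. -/
def rowOf (x : ℕ) : ℕ := Nat.shiftLeft 65535 (Nat.mul 16 x)

/-- The bits of column `x + 1` of a matrix with 16 columns. -/
def colOf (x : ℕ) : ℕ := Nat.shiftLeft col0 (Nat.succ x)

/-- Bit `16 f` of the result tells whether row `f` of `m` is nonzero. -/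
def spread (m : ℕ) : ℕ :=
  force (Nat.lor m (Nat.shiftRight m 1)) fun a =>
  force (Nat.lor a (Nat.shiftRight a 2)) fun b =>
  force (Nat.lor b (Nat.shiftRight b 4)) fun c =>
  Nat.land (Nat.lor c (Nat.shiftRight c 8)) col0

/-- The numeral with bits `0, 8, …, 248`. -/
def byte0 : ℕ := 454086624460063511464984254936031011189294057512315937409637584344757371137

/-- The number of nonzero bits of `m`, provided it is small. -/
def popcount (m : ℕ) : ℕ :=
  Nat.mod (Nat.rec 0 (fun j s => Nat.add (Nat.land (Nat.shiftRight m j) byte0) s) 8) 255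

/-- Does `m` have at least `n` nonzero bits? -/
def atLeast (n m : ℕ) : Bool := Nat.ble n (popcount m)

/-- The counting test showing that a state cannot be resolved in `w` weighings; `r` is the matrix
of possible pairs, with candidates marked in column `0`, and `g` its symmetric part. -/
def quick (w r g : ℕ) : Bool :=
  force (spread r) fun s =>
  Nat.rec (atLeast 3 s)
    (fun v _ => force (spread g) fun t =>
      force (Nat.lor g (Nat.xor (Nat.lor s t) t)) fun e =>
      atLeast (Nat.succ (Nat.mul 2 (Nat.pow 3 (Nat.succ v)))) e) w

/-- The rows and the columns of the coins placed on the right pan, off the scale, and on the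
left pan. -/
structure Pos where
  (rm r0 rp cm c0 cp : ℕ)

/-- The pairs of placed coins that may survive the given outcome with offset `0` or `1`. -/
def maskR (d : Bool) (o : Ordering) (q : Pos) : ℕ :=
  let call := Nat.lor col0 (Nat.lor q.cm (Nat.lor q.c0 q.cp))
  match d, o with
  | false, .lt => Nat.lor (Nat.land q.rp call) (Nat.land q.r0 q.cp)
  | false, .eq =>
    Nat.lor (Nat.land q.r0 call) (Nat.lor (Nat.land q.rp q.cm) (Nat.land q.rm q.cp))
  | false, .gt => Nat.lor (Nat.land q.rm call) (Nat.land q.r0 q.cm)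
  | true, .lt => Nat.land q.rp q.cp
  | true, .eq => Nat.lor (Nat.land q.rp call) (Nat.land q.r0 q.cp)
  | true, .gt => Nat.lor (Nat.land (Nat.lor q.r0 q.rm) call) (Nat.land q.rp q.cm)

/-- The pairs of placed coins that may survive the given outcome in both orders. -/
def maskG (d : Bool) (o : Ordering) (q : Pos) : ℕ :=
  match d, o with
  | false, .lt => Nat.lor (Nat.land q.rp (Nat.lor q.cp q.c0)) (Nat.land q.r0 q.cp)
  | false, .eq =>
    Nat.lor (Nat.land q.r0 q.c0) (Nat.lor (Nat.land q.rp q.cm) (Nat.land q.rm q.cp))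
  | false, .gt => Nat.lor (Nat.land q.rm (Nat.lor q.cm q.c0)) (Nat.land q.r0 q.cm)
  | true, .lt => Nat.land q.rp q.cp
  | true, .eq => Nat.lor (Nat.land q.rp (Nat.lor q.cp q.c0)) (Nat.land q.r0 q.cp)
  | true, .gt => Nat.lor (Nat.land (Nat.lor q.r0 q.rm) (Nat.lor q.c0 q.cm))
    (Nat.lor (Nat.land q.rp q.cm) (Nat.land q.rm q.cp))

/-- Continues with the matrices describing the state after outcome `o`. -/
def kid (r g : ℕ) (d : Bool) (q : Pos) (o : Ordering) (k : ℕ → ℕ → Bool) : Bool :=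
  force (Nat.land r (maskR d o q)) fun r' => k r' (Nat.land g (maskG d o q))

/-- Does some outcome satisfy `k`? -/
def some3 (k : Ordering → Bool) : Bool := k .eq || (k .lt || k .gt)

/-- Searches through all placements `q` of the listed coins, cut off by `prune` and tested by
`leaf` at the end; `true` means that every branch passes one of the two. -/
def dfs (prune : Pos → Bool) (leaf : Pos → ℕ → ℕ → Bool) (l : List (ℕ × ℕ)) :
    Pos → ℕ → ℕ → Bool :=
  List.rec (fun q s k => prune q || leaf q s k)
    (fun x _ ih q s k => prune q ||
      force (rowOf x.1) fun r => force (colOf x.1) fun c =>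
      force (Nat.mul 4 k) fun k =>
      (bit (Nat.lor q.c0 q.cp) x.2 ||
        force (Nat.lor q.rm r) fun r' => force (Nat.lor q.cm c) fun c' =>
        ih ⟨r', q.r0, q.rp, c', q.c0, q.cp⟩ s k) &&
      ((bit q.cp x.2 ||
        force (Nat.lor q.r0 r) fun r' => force (Nat.lor q.c0 c) fun c' =>
        force (Nat.succ s) fun s => force (Nat.succ k) fun k =>
        ih ⟨q.rm, r', q.rp, q.cm, c', q.cp⟩ s k) &&
        force (Nat.lor q.rp r) fun r' => force (Nat.lor q.cp c) fun c' =>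
        force (Nat.succ (Nat.succ s)) fun s => force (Nat.succ (Nat.succ k)) fun k =>
        ih ⟨q.rm, q.r0, r', q.cm, q.c0, c'⟩ s k)) l

/-- Is the matrix invariant under exchanging coins `x` and `y`? -/
def twin (m x y : ℕ) : Bool :=
  Nat.beq (bit m (16 * x)).toNat (bit m (16 * y)).toNat &&
  ((bit m (16 * x + (y + 1)) == bit m (16 * y + (x + 1))) &&
  (List.range 12).all fun f => Nat.beq f x || (Nat.beq f y ||
    ((bit m (16 * f + (x + 1)) == bit m (16 * f + (y + 1))) &&
      (bit m (16 * x + (f + 1)) == bit m (16 * y + (f + 1))))))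

/-- The coins that occur in a state, candidates first. -/
def coins (r : ℕ) : List ℕ :=
  (List.range 12).filter (fun x => bit r (16 * x)) ++
  (List.range 12).filter fun x =>
    !bit r (16 * x) && Nat.blt 0 (Nat.land r (colOf x))

/-- Pairs every coin `x` with `y + 1` for an interchangeable coin `y < x`, or with `0`. -/
def items (r g : ℕ) : List (ℕ × ℕ) :=
  (coins r).map fun x =>
    (x, ((coins r).filter fun y => Nat.blt y x && (twin r x y && twin g x y)).foldr
      (fun y m => Nat.max (Nat.succ y) m) 0)

/-- Is the diagonal empty? -/
def noDiag (m : ℕ) : Bool := (List.range 12).all fun x => !bit m (17 * x + 1)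

/-- Tries all placements for the state given by `r` and `g`, up to symmetries; if `ex` is set and
the offset is `0`, only those with equally many coins on both pans. -/
def node (ex : Bool) (w r g : ℕ) (sub : Bool → Pos → ℕ → Bool) : Bool :=
  noDiag r && (noDiag g &&
  let l := items r g
  let n := l.length
  let z := Pos.mk 0 0 0 0 0 0
  (dfs (fun q => some3 fun o => kid r g false q o (quick w))
    (fun q s k => cond ex (!Nat.beq s n) (Nat.blt s n) || sub false q k) l z 0 0 &&
  dfs (fun q => some3 fun o => kid r g true q o (quick w))
    (fun q _ k => sub true q k) l z 0 0))

/-- Completes the candidate marks. -/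
def close (r : ℕ) (k : ℕ → Bool) : Bool := force (Nat.lor r (spread r)) k

/-- Searches exhaustively for a strategy in `w` weighings; the value `true` means there is none. -/
def refute (w : ℕ) : ℕ → ℕ → Bool :=
  Nat.rec (fun r g => quick 0 r g)
    (fun v ih r g => node false v r g fun d q _ =>
      some3 fun o => kid r g d q o fun r' g' => close r' fun r' => force g' fun g' => ih r' g') w

theorem force_eq {α : Type} (x : ℕ) (k : ℕ → α) : force x k = k x := by
  cases x <;> rfl

theorem testBit_lor (a b i : ℕ) :
    (Nat.lor a b).testBit i = (a.testBit i || b.testBit i) := Nat.testBit_or a b i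

theorem testBit_land (a b i : ℕ) :
    (Nat.land a b).testBit i = (a.testBit i && b.testBit i) := Nat.testBit_and a b i

theorem testBit_xor (a b i : ℕ) :
    (Nat.xor a b).testBit i = (a.testBit i ^^ b.testBit i) := Nat.testBit_xor a b i

theorem testBit_shiftRight (a k i : ℕ) :
    (Nat.shiftRight a k).testBit i = a.testBit (k + i) := Nat.testBit_shiftRight a

theorem bit_eq (m n : ℕ) : bit m n = m.testBit n := by
  have h : Nat.land (Nat.shiftRight m n) 1 = m >>> n &&& 1 := rfl
  rw [bit, h, Nat.testBit, Nat.and_comm 1, Nat.and_one_is_mod]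
  rcases Nat.mod_two_eq_zero_or_one (m >>> n) with h | h <;> rw [h] <;> rfl

theorem testBit_col0 {i : ℕ} (h : col0.testBit i = true) : i % 16 = 0 := by
  have hlt : i < 256 := by
    by_contra hi
    have : col0 < 2 ^ i :=
      lt_of_lt_of_le (by decide : col0 < 2 ^ 256) (Nat.pow_le_pow_right (by norm_num) (by omega))
    rw [Nat.testBit_lt_two_pow this] at h
    cases h
  have : ∀ i < 256, col0.testBit i = true → i % 16 = 0 := by decide +kernel
  exact this i hlt h

theorem testBit_rowOf {x i : ℕ} (h : (rowOf x).testBit i = true) : i / 16 = x := by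
  have h' : ((2 ^ 16 - 1) <<< (16 * x)).testBit i = true := h
  rw [Nat.testBit_shiftLeft, Nat.testBit_two_pow_sub_one] at h'
  simp only [Bool.and_eq_true, decide_eq_true_eq] at h'
  omega

theorem testBit_colOf {x i : ℕ} (hx : x < 12) (h : (colOf x).testBit i = true) :
    i % 16 = x + 1 := by
  have h' : (col0 <<< (x + 1)).testBit i = true := h
  rw [Nat.testBit_shiftLeft] at h'
  simp only [Bool.and_eq_true, decide_eq_true_eq] at h'
  have := testBit_col0 h'.2
  omega

theorem testBit_spread {m i : ℕ} (h : (spread m).testBit i = true) :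
    i % 16 = 0 ∧ ∃ k < 16, m.testBit (i + k) = true := by
  simp only [spread, force_eq, testBit_lor, testBit_land, testBit_shiftRight, Bool.and_eq_true]
    at h
  refine ⟨testBit_col0 h.2, ?_⟩
  by_contra! hk
  have hf : ∀ k < 16, m.testBit (i + k) = false := fun k hk' => by simpa using hk k hk'
  have e : ∀ d k : ℕ, d + (i + k) = i + (d + k) := fun d k => by omega
  have e1 : ∀ d : ℕ, d + i = i + d := fun d => by omega
  simp only [e1, e, Nat.reduceAdd] at h
  have h0 := hf 0 (by norm_num)
  rw [add_zero] at h0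
  simp [hf, h0] at h

theorem spread_of_testBit {m i : ℕ} (hi : i < 256) (h : m.testBit i = true) :
    (spread m).testBit (16 * (i / 16)) = true := by
  have hc : ∀ j < 16, col0.testBit (16 * j) = true := by decide +kernel
  have hi' : i = 16 * (i / 16) + i % 16 := by omega
  have hc' := hc (i / 16) (by omega)
  rw [hi'] at h
  have hr : i % 16 < 16 := by omega
  generalize 16 * (i / 16) = j at h hc' ⊢
  generalize i % 16 = r at h hr
  simp only [spread, force_eq, testBit_lor, testBit_land, testBit_shiftRight, hc']
  have e : ∀ d k : ℕ, d + (j + k) = j + (d + k) := fun d k => by omega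
  have e1 : ∀ d : ℕ, d + j = j + d := fun d => by omega
  simp only [e1, e, Nat.reduceAdd]
  clear e e1 hi' hi hc hc'
  interval_cases r <;> (try rw [add_zero] at h) <;>
    simp only [h, Bool.true_or, Bool.or_true, Bool.and_true]

theorem testBit_byte0 {i : ℕ} (h : byte0.testBit i = true) : i % 8 = 0 := by
  have hlt : i < 256 := by
    by_contra hi
    have : byte0 < 2 ^ i :=
      lt_of_lt_of_le (by decide : byte0 < 2 ^ 256) (Nat.pow_le_pow_right (by norm_num) (by omega))
    rw [Nat.testBit_lt_two_pow this] at h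
    cases h
  have : ∀ i < 256, byte0.testBit i = true → i % 8 = 0 := by decide +kernel
  exact this i hlt h

theorem modEq_card_bitIndices {x : ℕ} (h : ∀ i, x.testBit i = true → i % 8 = 0) :
    x ≡ x.bitIndices.toFinset.card [MOD 255] := by
  have hs := Finset.sum_toFinset_bitIndices_two_pow x
  rw [Finset.card_eq_sum_ones]
  conv_lhs => rw [← hs]
  refine Nat.ModEq.sum fun i hi => ?_
  rw [List.mem_toFinset, Nat.mem_bitIndices] at hi
  rw [show i = 8 * (i / 8) by have := h i hi; omega, pow_mul]
  simpa using (show 2 ^ 8 ≡ 1 [MOD 255] by decide).pow (i / 8)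

theorem popcount_le (m : ℕ) : popcount m ≤ m.bitIndices.toFinset.card := by
  have key : ∀ J ≤ 8, ∃ C,
      C ≤ (m.bitIndices.toFinset.filter fun i => i % 8 < J).card ∧
      (Nat.rec 0 (fun j s => Nat.add (Nat.land (Nat.shiftRight m j) byte0) s) J : ℕ)
        ≡ C [MOD 255] := by
    intro J
    induction J with
    | zero => exact fun _ => ⟨0, Nat.zero_le _, rfl⟩
    | succ J ih =>
      intro hJ
      obtain ⟨C, hC, hmod⟩ := ih (by omega)
      have hbit : ∀ i, (Nat.land (Nat.shiftRight m J) byte0).testBit i = true →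
          i % 8 = 0 ∧ m.testBit (i + J) = true := fun i hi => by
        rw [testBit_land, testBit_shiftRight, Bool.and_eq_true, add_comm] at hi
        exact ⟨testBit_byte0 hi.2, hi.1⟩
      refine ⟨_, ?_, (modEq_card_bitIndices fun i hi => (hbit i hi).1).add hmod⟩
      rw [show (m.bitIndices.toFinset.filter fun i => i % 8 < J + 1) =
        (m.bitIndices.toFinset.filter fun i => i % 8 = J) ∪
          m.bitIndices.toFinset.filter fun i => i % 8 < J by
        rw [← Finset.filter_or]; exact Finset.filter_congr fun i _ => by omega,
        Finset.card_union_of_disjoint (Finset.disjoint_filter.2 fun i _ h => by omega)]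
      refine Nat.add_le_add (Finset.card_le_card_of_injOn (· + J) (fun i hi => ?_)
        (add_left_injective J).injOn) hC
      have := hbit i (by simpa using hi)
      simp only [Finset.coe_filter, List.mem_toFinset, Nat.mem_bitIndices, Set.mem_ofPred_eq]
      exact ⟨this.2, by omega⟩
  obtain ⟨C, hC, hmod⟩ := key 8 le_rfl
  refine le_trans ?_ (Finset.card_filter_le m.bitIndices.toFinset fun i => i % 8 < 8)
  refine le_trans ?_ hC
  change _ % 255 ≤ C
  rw [hmod]
  exact Nat.mod_le _ _

theorem atLeast_sound {n m : ℕ} (h : atLeast n m = true) :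
    ∃ E : Finset ℕ, E.card = n ∧ ∀ i ∈ E, m.testBit i = true := by
  obtain ⟨E, hE, hc⟩ := Finset.exists_subset_card_eq
    ((Nat.le_of_ble_eq_true h).trans (popcount_le m))
  exact ⟨E, hc, fun i hi => by simpa using hE hi⟩

/-- The matrices `r` and `g` describe pairs that are possible in the state `K`. -/
structure Approx (K : ℕ → ℕ → Prop) (r g : ℕ) : Prop where
  cand : ∀ i, r.testBit i = true → i % 16 = 0 → ∃ c, K (i / 16) c
  arc : ∀ i, r.testBit i = true → i % 16 ≠ 0 → i / 16 ≠ i % 16 - 1 ∧ K (i / 16) (i % 16 - 1)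
  sym : ∀ i, g.testBit i = true → i % 16 ≠ 0 ∧ i / 16 ≠ i % 16 - 1 ∧
    K (i / 16) (i % 16 - 1) ∧ K (i % 16 - 1) (i / 16)
  lt : ∀ i, g.testBit i = true → i < 256

theorem Approx.spread_cand {K : ℕ → ℕ → Prop} {r g : ℕ} (h : Approx K r g) {i : ℕ}
    (hi : (spread r).testBit i = true) : i % 16 = 0 ∧ ∃ c, K (i / 16) c := by
  obtain ⟨h0, k, hk, hb⟩ := testBit_spread hi
  refine ⟨h0, ?_⟩
  have e : (i + k) / 16 = i / 16 := by omega
  by_cases h1 : (i + k) % 16 = 0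
  · exact e ▸ h.cand _ hb h1
  · exact e ▸ ⟨_, (h.arc _ hb h1).2⟩

theorem quick_sound {K : ℕ → ℕ → Prop} {w r g : ℕ} (h : Approx K r g)
    (hq : quick w r g = true) : ¬ Solv K w := by
  intro hs
  cases w with
  | zero =>
    have hq' : force (spread r) (fun s => atLeast 3 s) = true := hq
    rw [force_eq] at hq'
    obtain ⟨E, hE, hb⟩ := atLeast_sound hq'
    have := hs.card_le E (fun i hi => ?_) fun i hi j hj _ hij => ?_
    · omega
    · obtain ⟨h0, h1⟩ := h.spread_cand (hb i hi)
      rwa [Good, if_pos h0]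
    · have := (h.spread_cand (hb i hi)).1
      have := (h.spread_cand (hb j hj)).1
      omega
  | succ v =>
    have hq' : force (spread r) (fun s => force (spread g) fun t =>
      force (Nat.lor g (Nat.xor (Nat.lor s t) t)) fun e =>
      atLeast (Nat.succ (Nat.mul 2 (Nat.pow 3 (Nat.succ v)))) e) = true := hq
    simp only [force_eq] at hq'
    obtain ⟨E, hE, hb⟩ := atLeast_sound hq'
    have hcard : E.card = 2 * 3 ^ (v + 1) + 1 := hE
    have hb' : ∀ i ∈ E, g.testBit i = true ∨
        ((spread r).testBit i = true ∧ (spread g).testBit i = false) := fun i hi => by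
      have := hb i hi
      rw [testBit_lor, testBit_xor, testBit_lor] at this
      cases h1 : g.testBit i <;> cases h2 : (spread g).testBit i <;>
        cases h3 : (spread r).testBit i <;> simp_all
    have := hs.card_le E (fun i hi => ?_) fun i hi j hj h0 hij => ?_
    · omega
    · rcases hb' i hi with h1 | ⟨h1, -⟩
      · rw [Good, if_neg (h.sym i h1).1]
        exact (h.sym i h1).2
      · obtain ⟨h0, h2⟩ := h.spread_cand h1
        rwa [Good, if_pos h0]
    · rcases hb' i hi with h1 | ⟨-, h1⟩
      · exact absurd h0 (h.sym i h1).1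
      rcases hb' j hj with h2 | ⟨h2, -⟩
      · have := spread_of_testBit (h.lt j h2) h2
        rw [← hij, show 16 * (i / 16) = i by omega, h1] at this
        cases this
      · have := (h.spread_cand h2).1
        omega

/-- The masks in `q` agree with the placement `p`. -/
structure Cons (q : Pos) (p : ℕ → ℤ) : Prop where
  rm : ∀ i, q.rm.testBit i = true → i / 16 < 12 ∧ p (i / 16) = -1
  r0 : ∀ i, q.r0.testBit i = true → i / 16 < 12 ∧ p (i / 16) = 0
  rp : ∀ i, q.rp.testBit i = true → i / 16 < 12 ∧ p (i / 16) = 1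
  cm : ∀ i, q.cm.testBit i = true → i % 16 ≠ 0 ∧ i % 16 - 1 < 12 ∧ p (i % 16 - 1) = -1
  c0 : ∀ i, q.c0.testBit i = true → i % 16 ≠ 0 ∧ i % 16 - 1 < 12 ∧ p (i % 16 - 1) = 0
  cp : ∀ i, q.cp.testBit i = true → i % 16 ≠ 0 ∧ i % 16 - 1 < 12 ∧ p (i % 16 - 1) = 1

/-- The offset encoded by a Boolean. -/
def off (d : Bool) : ℤ := if d then 1 else 0

theorem maskR_sound {q : Pos} {p : ℕ → ℤ} (h : Cons q p) {d : Bool} {o : Ordering} {i : ℕ}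
    (hi : (maskR d o q).testBit i = true) :
    i / 16 < 12 ∧ (i % 16 = 0 → compare (off d) (p (i / 16)) = o) ∧
    (i % 16 ≠ 0 → i % 16 - 1 < 12 ∧ (compare (off d) (p (i / 16)) = o ∨
      compare (off d) (p (i / 16) + p (i % 16 - 1)) = o)) := by
  have hm := h.rm i
  have h0 := h.r0 i
  have hp := h.rp i
  have km := h.cm i
  have k0 := h.c0 i
  have kp := h.cp i
  have kc := @testBit_col0 i
  revert hi
  cases d <;> cases o <;>
    simp only [maskR, testBit_lor, testBit_land, off, Bool.or_eq_true, Bool.and_eq_true,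
      Int.compare_eq_lt, Int.compare_eq_eq, Int.compare_eq_gt, if_true, if_false,
      Bool.false_eq_true] <;>
    grind

theorem maskG_sound {q : Pos} {p : ℕ → ℤ} (h : Cons q p) {d : Bool} {o : Ordering} {i : ℕ}
    (hi : (maskG d o q).testBit i = true) :
    i / 16 < 12 ∧ i % 16 ≠ 0 ∧ i % 16 - 1 < 12 ∧
    (compare (off d) (p (i / 16)) = o ∧ compare (off d) (p (i % 16 - 1)) = o ∨
      compare (off d) (p (i / 16) + p (i % 16 - 1)) = o) := by
  have hm := h.rm i
  have h0 := h.r0 i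
  have hp := h.rp i
  have km := h.cm i
  have k0 := h.c0 i
  have kp := h.cp i
  revert hi
  cases d <;> cases o <;>
    simp only [maskG, testBit_lor, testBit_land, off, Bool.or_eq_true, Bool.and_eq_true,
      Int.compare_eq_lt, Int.compare_eq_eq, Int.compare_eq_gt, if_true, if_false,
      Bool.false_eq_true] <;>
    grind

/-- The pairs described by two matrices on the coins `0, …, 11`. -/
def rel (r g f c : ℕ) : Prop :=
  f < 12 ∧ c < 12 ∧ if f = c then r.testBit (16 * f) = true else
    r.testBit (16 * f + (c + 1)) = true ∨ g.testBit (16 * f + (c + 1)) = true ∨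
      g.testBit (16 * c + (f + 1)) = true

theorem noDiag_sound {m : ℕ} (h : noDiag m = true) {i : ℕ} (hi : i / 16 < 12)
    (hb : m.testBit i = true) (h0 : i % 16 ≠ 0) : i / 16 ≠ i % 16 - 1 := by
  intro e
  rw [noDiag, List.all_eq_true] at h
  have := h (i / 16) (List.mem_range.2 hi)
  rw [bit_eq, show 17 * (i / 16) + 1 = i by omega, hb] at this
  cases this

theorem approx_kid {r g : ℕ} (hr : noDiag r = true) (hg : noDiag g = true) {q : Pos} {p : ℕ → ℤ}
    (h : Cons q p) (d : Bool) (o : Ordering) :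
    Approx (step (rel r g) p (off d) o) (Nat.land r (maskR d o q))
      (Nat.land g (maskG d o q)) where
  cand i hi h0 := by
    rw [testBit_land, Bool.and_eq_true] at hi
    obtain ⟨h1, h2, -⟩ := maskR_sound h hi.2
    refine ⟨i / 16, ?_⟩
    rw [step, if_pos rfl]
    refine ⟨⟨i / 16, h1, h1, ?_⟩, h2 h0⟩
    rw [if_pos rfl, show 16 * (i / 16) = i by omega]
    exact hi.1
  arc i hi h0 := by
    rw [testBit_land, Bool.and_eq_true] at hi
    obtain ⟨h1, -, h2⟩ := maskR_sound h hi.2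
    have hne := noDiag_sound hr h1 hi.1 h0
    refine ⟨hne, ?_⟩
    rw [step, if_neg hne]
    refine ⟨⟨h1, (h2 h0).1, ?_⟩, (h2 h0).2⟩
    rw [if_neg hne, show 16 * (i / 16) + (i % 16 - 1 + 1) = i by omega]
    exact Or.inl hi.1
  sym i hi := by
    rw [testBit_land, Bool.and_eq_true] at hi
    obtain ⟨h1, h0, h2, h3⟩ := maskG_sound h hi.2
    have hne := noDiag_sound hg h1 hi.1 h0
    have e : 16 * (i / 16) + (i % 16 - 1 + 1) = i := by omega
    refine ⟨h0, hne, ?_, ?_⟩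
    · rw [step, if_neg hne]
      refine ⟨⟨h1, h2, ?_⟩, h3.imp And.left id⟩
      rw [if_neg hne, e]
      exact Or.inr (Or.inl hi.1)
    · rw [step, if_neg hne.symm, add_comm (p (i % 16 - 1))]
      refine ⟨⟨h2, h1, ?_⟩, h3.imp And.right id⟩
      rw [if_neg hne.symm, e]
      exact Or.inr (Or.inr hi.1)
  lt i hi := by
    rw [testBit_land, Bool.and_eq_true] at hi
    have := (maskG_sound h hi.2).1
    omega

theorem Approx.solv_rel {K : ℕ → ℕ → Prop} {r g w : ℕ} (h : Approx K r g) (hs : Solv K w) :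
    Solv (rel (Nat.lor r (spread r)) g) w := by
  have harc : ∀ f c, f ≠ c → rel (Nat.lor r (spread r)) g f c → K f c := by
    rintro f c hne ⟨hf, hc, hb⟩
    rw [if_neg hne, testBit_lor, Bool.or_eq_true] at hb
    have e1 : (16 * f + (c + 1)) / 16 = f := by omega
    have e2 : (16 * f + (c + 1)) % 16 - 1 = c := by omega
    have e3 : (16 * c + (f + 1)) / 16 = c := by omega
    have e4 : (16 * c + (f + 1)) % 16 - 1 = f := by omega
    rcases hb with (hb | hb) | hb | hb
    · have := (h.arc _ hb (by omega)).2
      rwa [e1, e2] at this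
    · have := (testBit_spread hb).1
      omega
    · have := (h.sym _ hb).2.2.1
      rwa [e1, e2] at this
    · have := (h.sym _ hb).2.2.2
      rwa [e3, e4] at this
  refine hs.sub harc fun f c hfc => ?_
  by_cases hne : f = c
  · obtain ⟨hf, -, hb⟩ := hfc
    rw [if_pos hne, testBit_lor, Bool.or_eq_true] at hb
    have e : 16 * f / 16 = f := by omega
    rcases hb with hb | hb
    · exact e ▸ h.cand _ hb (by omega)
    · exact e ▸ (h.spread_cand hb).2
  · exact ⟨c, harc f c hne hfc⟩

theorem some3_eq_true {k : Ordering → Bool} : some3 k = true ↔ ∃ o, k o = true := by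
  simp only [some3, Bool.or_eq_true]
  constructor
  · rintro (h | h | h) <;> exact ⟨_, h⟩
  · rintro ⟨o, h⟩
    cases o <;> simp [h]

theorem dfs_sound {prune : Pos → Bool} {leaf : Pos → ℕ → ℕ → Bool} {p : ℕ → ℤ} (hp : IsPos p)
    {F : Prop} (hprune : ∀ q, Cons q p → prune q = true → F) (S : ℕ)
    (hleaf : ∀ q k, Cons q p → leaf q S k = true → F) (l : List (ℕ × ℕ))
    (hl : ∀ x ∈ l, x.1 < 12 ∧ ∀ y, x.2 = y + 1 → y < 12 ∧ p y ≤ p x.1) {q : Pos} {s k : ℕ}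
    (h : dfs prune leaf l q s k = true) (hq : Cons q p)
    (hs : (S : ℤ) = s + (l.map fun x => p x.1 + 1).sum) : F := by
  induction l generalizing q s k with
  | nil =>
    have h' : (prune q || leaf q s k) = true := h
    have : S = s := by simpa using hs
    rw [Bool.or_eq_true] at h'
    exact h'.elim (hprune q hq) fun h => hleaf q k hq (this ▸ h)
  | cons x l ih =>
    have h' : (prune q || force (rowOf x.1) fun r => force (colOf x.1) fun c =>
      force (Nat.mul 4 k) fun k =>
      (bit (Nat.lor q.c0 q.cp) x.2 ||
        force (Nat.lor q.rm r) fun r' => force (Nat.lor q.cm c) fun c' =>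
        dfs prune leaf l ⟨r', q.r0, q.rp, c', q.c0, q.cp⟩ s k) &&
      ((bit q.cp x.2 ||
        force (Nat.lor q.r0 r) fun r' => force (Nat.lor q.c0 c) fun c' =>
        force (Nat.succ s) fun s => force (Nat.succ k) fun k =>
        dfs prune leaf l ⟨q.rm, r', q.rp, q.cm, c', q.cp⟩ s k) &&
        force (Nat.lor q.rp r) fun r' => force (Nat.lor q.cp c) fun c' =>
        force (Nat.succ (Nat.succ s)) fun s => force (Nat.succ (Nat.succ k)) fun k =>
        dfs prune leaf l ⟨q.rm, q.r0, r', q.cm, q.c0, c'⟩ s k)) = true := h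
    simp only [force_eq, bit_eq, Bool.or_eq_true, Bool.and_eq_true, testBit_lor] at h'
    obtain ⟨hx, hy⟩ := hl x (by simp)
    have ih := @ih fun y hy => hl y (by simp [hy])
    rw [List.map_cons, List.sum_cons] at hs
    have hrow : ∀ (m i : ℕ) (a : ℤ), p x.1 = a →
        (m.testBit i = true → i / 16 < 12 ∧ p (i / 16) = a) →
        (Nat.lor m (rowOf x.1)).testBit i = true → i / 16 < 12 ∧ p (i / 16) = a := by
      intro m i a ha hm hi
      rw [testBit_lor, Bool.or_eq_true] at hi
      rcases hi with hi | hi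
      · exact hm hi
      · rw [testBit_rowOf hi]
        exact ⟨hx, ha⟩
    have hcol : ∀ (m i : ℕ) (a : ℤ), p x.1 = a →
        (m.testBit i = true → i % 16 ≠ 0 ∧ i % 16 - 1 < 12 ∧ p (i % 16 - 1) = a) →
        (Nat.lor m (colOf x.1)).testBit i = true →
        i % 16 ≠ 0 ∧ i % 16 - 1 < 12 ∧ p (i % 16 - 1) = a := by
      intro m i a ha hm hi
      rw [testBit_lor, Bool.or_eq_true] at hi
      rcases hi with hi | hi
      · exact hm hi
      · have := testBit_colOf hx hi
        rw [this, Nat.add_sub_cancel]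
        exact ⟨by omega, hx, ha⟩
    have hpred : ∀ a : ℤ, (x.2 % 16 ≠ 0 ∧ x.2 % 16 - 1 < 12 ∧ p (x.2 % 16 - 1) = a) →
        a ≤ p x.1 := by
      rintro a ⟨h0, -, h2⟩
      obtain ⟨y, e⟩ : ∃ y, x.2 = y + 1 := ⟨x.2 - 1, by omega⟩
      obtain ⟨h3, h4⟩ := hy y e
      rw [show x.2 % 16 - 1 = y by omega] at h2
      omega
    rcases h' with h' | ⟨h1, h2, h3⟩
    · exact hprune q hq h'
    rcases hp x.1 with e | e | e
    · rcases h1 with (h1 | h1) | h1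
      · have := hpred _ (hq.c0 _ h1)
        omega
      · have := hpred _ (hq.cp _ h1)
        omega
      · exact ih h1 ⟨fun i => hrow _ i _ e (hq.rm i), hq.r0, hq.rp,
          fun i => hcol _ i _ e (hq.cm i), hq.c0, hq.cp⟩ (by rw [hs, e]; ring)
    · rcases h2 with h2 | h2
      · have := hpred _ (hq.cp _ h2)
        omega
      · exact ih h2 ⟨hq.rm, fun i => hrow _ i _ e (hq.r0 i), hq.rp,
          hq.cm, fun i => hcol _ i _ e (hq.c0 i), hq.cp⟩ (by rw [hs, e]; push_cast; ring)
    · exact ih h3 ⟨hq.rm, hq.r0, fun i => hrow _ i _ e (hq.rp i),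
          hq.cm, hq.c0, fun i => hcol _ i _ e (hq.cp i)⟩ (by rw [hs, e]; push_cast; ring)

theorem twin_sound {m x y : ℕ} (h : twin m x y = true) {f c : ℕ}
    (hf : f < 12) (hc : c < 12) :
    m.testBit (16 * Equiv.swap x y f) = m.testBit (16 * f) ∧
    (f ≠ c → m.testBit (16 * Equiv.swap x y f + (Equiv.swap x y c + 1)) =
      m.testBit (16 * f + (c + 1))) := by
  simp only [twin, bit_eq, Bool.and_eq_true, List.all_eq_true, List.mem_range, Bool.or_eq_true,
    beq_iff_eq, Nat.beq_eq] at h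
  obtain ⟨h1, h2, h3⟩ := h
  have h1' : m.testBit (16 * x) = m.testBit (16 * y) := by
    revert h1
    cases m.testBit (16 * x) <;> cases m.testBit (16 * y) <;> simp
  have hf3 := h3 f hf
  have hc3 := h3 c hc
  simp only [Equiv.swap_apply_def]
  split_ifs <;> grind

theorem sum_swap (I : Finset ℕ) (ω p : ℕ → ℤ) {x y : ℕ} (hx : x ∈ I) (hy : y ∈ I) (hne : x ≠ y) :
    ∑ i ∈ I, ω i * p (Equiv.swap x y i) = ∑ i ∈ I, ω i * p i + (ω x - ω y) * (p y - p x) := by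
  rw [← sub_eq_iff_eq_add', ← Finset.sum_sub_distrib,
    Finset.sum_eq_add_of_mem x y hx hy hne]
  · rw [Equiv.swap_apply_left, Equiv.swap_apply_right]
    ring
  · intro c _ hc
    rw [Equiv.swap_apply_of_ne_of_ne hc.1 hc.2, sub_self]

/-- Among the placements with a property that is invariant under some transpositions, there is one
that is monotone along them; if the property is also invariant under exchanging the pans, the left
pan can be assumed to carry at least as many coins as the right pan. -/
theorem arrange (I : Finset ℕ) (hI : ∀ i ∈ I, i < 12) (W : (ℕ → ℤ) → Prop) (Tw : ℕ → ℕ → Prop)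
    (hTw : ∀ x y, Tw x y → x ∈ I ∧ y ∈ I ∧ y < x)
    (hsw : ∀ x y p, Tw x y → W p → W (p ∘ Equiv.swap x y)) (hpos : ∀ p, W p → IsPos p)
    (hW : ∃ p, W p) :
    ∃ p, W p ∧ (∀ x y, Tw x y → p y ≤ p x) ∧ ((∀ q, W q → W (-q)) → 0 ≤ ∑ i ∈ I, p i) := by
  let Φ : (ℕ → ℤ) → ℤ := fun p => ∑ i ∈ I, ((i : ℤ) + 200) * p i
  obtain ⟨z, ⟨p, hp, hz⟩, hmax⟩ := Int.exists_greatest_of_bdd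
    (P := fun z => ∃ p, W p ∧ Φ p = z)
    ⟨∑ i ∈ I, ((i : ℤ) + 200), by
      rintro z ⟨p, hp, rfl⟩
      refine Finset.sum_le_sum fun i _ => ?_
      rcases hpos p hp i with h | h | h <;> rw [h] <;> omega⟩
    (hW.elim fun p hp => ⟨_, p, hp, rfl⟩)
  refine ⟨p, hp, fun x y hxy => ?_, fun hneg => ?_⟩
  · obtain ⟨hx, hy, hlt⟩ := hTw x y hxy
    have h1 := hmax _ ⟨_, hsw x y p hxy hp, rfl⟩
    have h2 : Φ (p ∘ Equiv.swap x y) = _ := sum_swap I _ p hx hy hlt.ne'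
    have h3 : (0 : ℤ) < (x : ℤ) - y := by omega
    have h4 : ((x : ℤ) - y) * (p y - p x) ≤ 0 := by
      change Φ (p ∘ Equiv.swap x y) = Φ p + ((x : ℤ) + 200 - ((y : ℤ) + 200)) * _ at h2
      rw [add_sub_add_right_eq_sub] at h2
      omega
    by_contra! hcon
    nlinarith
  · have h1 := hmax _ ⟨_, hneg p hp, rfl⟩
    have h2 : Φ (-p) = -Φ p := by
      simp only [Φ, Pi.neg_apply, mul_neg, Finset.sum_neg_distrib]
    have h3 : Φ p = ∑ i ∈ I, (i : ℤ) * p i + 200 * ∑ i ∈ I, p i := by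
      simp only [Φ, add_mul, Finset.sum_add_distrib, Finset.mul_sum]
    have h4 : ∑ i ∈ I, (i : ℤ) * p i ≤ ∑ i ∈ I, (11 : ℤ) := by
      refine Finset.sum_le_sum fun i hi => ?_
      have := hI i hi
      rcases hpos p hp i with h | h | h <;> rw [h] <;> omega
    have h5 : I.card ≤ 12 := by
      simpa using Finset.card_le_card (t := Finset.range 12) fun i hi => by simpa using hI i hi
    rw [Finset.sum_const, nsmul_eq_mul] at h4
    have h6 : (I.card : ℤ) ≤ 12 := by exact_mod_cast h5
    by_contra! hcon
    omega

theorem nodup_coins (r : ℕ) : (coins r).Nodup := by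
  refine List.Nodup.append (List.nodup_range.filter _) (List.nodup_range.filter _) ?_
  intro x hx hy
  simp only [List.mem_filter, Bool.and_eq_true, Bool.not_eq_true'] at hx hy
  rw [hx.2] at hy
  exact absurd hy.2.1 (by simp)

theorem lt_of_mem_coins {r x : ℕ} (h : x ∈ coins r) : x < 12 := by
  simp only [coins, List.mem_append, List.mem_filter, List.mem_range] at h
  exact h.elim And.left And.left

theorem mem_of_foldr_max {l : List ℕ} {y : ℕ}
    (h : l.foldr (fun y m => Nat.max (Nat.succ y) m) 0 = y + 1) : y ∈ l := by
  induction l with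
  | nil => simp at h
  | cons a l ih =>
    rw [List.foldr_cons] at h
    rcases max_choice (Nat.succ a) (l.foldr (fun y m => Nat.max (Nat.succ y) m) 0) with h' | h'
    · rw [show y = a by have := h.symm.trans h'; omega]
      simp
    · exact List.mem_cons_of_mem _ (ih (h'.symm.trans h))

theorem mem_items {r g : ℕ} {x : ℕ × ℕ} (h : x ∈ items r g) : x.1 ∈ coins r ∧
    ∀ y, x.2 = y + 1 → y ∈ coins r ∧ y < x.1 ∧ twin r x.1 y = true ∧ twin g x.1 y = true := by
  obtain ⟨a, ha, rfl⟩ := List.mem_map.1 h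
  refine ⟨ha, fun y hy => ?_⟩
  have := mem_of_foldr_max hy
  simp only [List.mem_filter, Bool.and_eq_true, Nat.blt_eq] at this
  exact ⟨this.1, this.2.1, this.2.2⟩

theorem rel_swap {r g x y : ℕ} (hx : x < 12) (hy : y < 12) (hr : twin r x y = true)
    (hg : twin g x y = true) {f c : ℕ} (h : rel r g f c) :
    rel r g (Equiv.swap x y f) (Equiv.swap x y c) := by
  have hlt : ∀ z < 12, Equiv.swap x y z < 12 := fun z hz => by
    rw [Equiv.swap_apply_def]
    split_ifs <;> assumption
  obtain ⟨hf, hc, h⟩ := h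
  refine ⟨hlt f hf, hlt c hc, ?_⟩
  by_cases e : f = c
  · rw [if_pos (e ▸ rfl), (twin_sound hr hf hc).1]
    rwa [if_pos e] at h
  · rw [if_neg fun e' => e ((Equiv.swap x y).injective e'), (twin_sound hr hf hc).2 e,
      (twin_sound hg hf hc).2 e, (twin_sound hg hc hf).2 (Ne.symm e)]
    rwa [if_neg e] at h

theorem step_comp {K : ℕ → ℕ → Prop} (σ : Equiv.Perm ℕ) (hK : ∀ f c, K f c → K (σ f) (σ c))
    {p : ℕ → ℤ} {d : ℤ} {o : Ordering} {f c : ℕ} (h : step K (p ∘ σ) d o f c) :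
    step K p d o (σ f) (σ c) := by
  unfold step at h ⊢
  split_ifs at h with e
  · rw [if_pos (e ▸ rfl)]
    exact ⟨h.1.imp' σ fun c => hK f c, h.2⟩
  · rw [if_neg fun e' => e (σ.injective e')]
    exact ⟨hK _ _ h.1, h.2⟩

theorem step_neg {K : ℕ → ℕ → Prop} {p : ℕ → ℤ} {o : Ordering} {f c : ℕ}
    (h : step K (-p) 0 o f c) : step K p 0 o.swap f c := by
  have key : ∀ a : ℤ, compare (0 : ℤ) (-a) = o → compare 0 a = o.swap := fun a ha => by
    rw [← ha, ← compare_neg, neg_neg, neg_zero]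
  unfold step at h ⊢
  split_ifs at h ⊢ with e
  · exact ⟨h.1, key _ h.2⟩
  · refine ⟨h.1, h.2.imp (key _) fun h2 => key _ ?_⟩
    rw [← h2, Pi.neg_apply, Pi.neg_apply, neg_add]

theorem node_sound {ex : Bool} {w r g : ℕ} {sub : Bool → Pos → ℕ → Bool}
    (h : node ex w r g sub = true)
    (hsub : ∀ d q k p, IsPos p → Cons q p → sub d q k = true →
      ¬ ∀ o, Solv (step (rel r g) p (off d) o) w)
    (p : ℕ → ℤ) (hp : IsPos p) (d : Bool)
    (hex : ex = true → d = false → ∑ i ∈ (coins r).toFinset, p i = 0) :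
    ¬ ∀ o, Solv (step (rel r g) p (off d) o) w := by
  intro hs
  obtain ⟨hr, hg, h0, h1⟩ : noDiag r = true ∧ noDiag g = true ∧
      dfs (fun q => some3 fun o => kid r g false q o (quick w))
        (fun q s k => cond ex (!Nat.beq s (items r g).length) (Nat.blt s (items r g).length) ||
          sub false q k) (items r g) ⟨0, 0, 0, 0, 0, 0⟩ 0 0 = true ∧
      dfs (fun q => some3 fun o => kid r g true q o (quick w))
        (fun q _ k => sub true q k) (items r g) ⟨0, 0, 0, 0, 0, 0⟩ 0 0 = true := by
    simpa only [node, Bool.and_eq_true] using h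
  have hI : ∀ i ∈ (coins r).toFinset, i < 12 := fun i hi =>
    lt_of_mem_coins (List.mem_toFinset.1 hi)
  obtain ⟨p, ⟨hp, hex, hs⟩, htw, hneg⟩ := arrange (coins r).toFinset hI
    (fun p => IsPos p ∧ (ex = true → d = false → ∑ i ∈ (coins r).toFinset, p i = 0) ∧
      ∀ o, Solv (step (rel r g) p (off d) o) w)
    (fun x y => x ∈ (coins r).toFinset ∧ y ∈ (coins r).toFinset ∧ y < x ∧
      twin r x y = true ∧ twin g x y = true)
    (fun x y hxy => ⟨hxy.1, hxy.2.1, hxy.2.2.1⟩)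
    (fun x y p hxy hp => by
      obtain ⟨hx, hy, hlt, htr, htg⟩ := hxy
      refine ⟨fun i => hp.1 _, fun he hd => ?_, fun o => ?_⟩
      · have := sum_swap (coins r).toFinset (fun _ => 1) p hx hy hlt.ne'
        simp only [one_mul, sub_self, zero_mul, add_zero] at this
        exact this.trans (hp.2.1 he hd)
      · have hst := fun f c => step_comp (K := rel r g) (p := p) (d := off d) (o := o) (f := f) (c := c)
          (Equiv.swap x y) fun f c => rel_swap (hI x hx) (hI y hy) htr htg
        exact (hp.2.2 o).embed (Equiv.swap x y) Set.univ (Equiv.injective _).injOn (by simp)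
          (fun f c _ h => hst f c h) fun f c h => ⟨_, hst f c h⟩)
    (fun p hp => hp.1) ⟨p, hp, hex, hs⟩
  have hz : Cons ⟨0, 0, 0, 0, 0, 0⟩ p := by constructor <;> simp
  have hprune : ∀ d' q, d' = d → Cons q p →
      (some3 fun o => kid r g d' q o (quick w)) = true → False := by
    rintro _ q rfl hq hk
    obtain ⟨o, hk⟩ := some3_eq_true.1 hk
    rw [kid, force_eq] at hk
    exact quick_sound (approx_kid hr hg hq _ o) hk (hs o)
  have hl : ∀ x ∈ items r g, x.1 < 12 ∧ ∀ y, x.2 = y + 1 → y < 12 ∧ p y ≤ p x.1 := by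
    intro x hx
    obtain ⟨hx1, hx2⟩ := mem_items hx
    refine ⟨lt_of_mem_coins hx1, fun y hy => ?_⟩
    obtain ⟨hy1, hy2⟩ := hx2 y hy
    exact ⟨lt_of_mem_coins hy1, htw _ _ ⟨List.mem_toFinset.2 hx1, List.mem_toFinset.2 hy1, hy2⟩⟩
  have hsum : ((items r g).map fun x => p x.1 + 1).sum =
      ∑ i ∈ (coins r).toFinset, p i + (items r g).length := by
    rw [List.sum_toFinset _ (nodup_coins r), items, List.map_map, List.length_map]
    change ((coins r).map fun x => p x + 1).sum = _
    rw [List.sum_map_add]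
    simp
  have hnn : 0 ≤ ((items r g).map fun x => p x.1 + 1).sum := by
    refine List.sum_nonneg fun a ha => ?_
    obtain ⟨x, -, rfl⟩ := List.mem_map.1 ha
    rcases hp x.1 with h | h | h <;> rw [h] <;> norm_num
  obtain ⟨S, hS⟩ := Int.eq_ofNat_of_zero_le hnn
  have hS' : (S : ℤ) = ((0 : ℕ) : ℤ) + ((items r g).map fun x => p x.1 + 1).sum := by
    rw [hS]; simp
  cases d with
  | false =>
    refine dfs_sound hp (fun q => hprune _ q rfl) S (fun q k hq hk => ?_) _ hl h0 hz hS'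
    rw [Bool.or_eq_true] at hk
    rcases hk with hk | hk
    · cases ex with
      | false =>
        have h1 : S < (items r g).length := by simpa using hk
        have h2 := hneg fun q hq => ⟨fun i => by rcases hq.1 i with h | h | h <;> simp [h],
          by simp, fun o => (hq.2.2 o.swap).mono fun f c h => step_neg h⟩
        omega
      | true =>
        have h1 : S ≠ (items r g).length := by
          rintro rfl
          simp [Nat.beq_refl] at hk
        have h2 := hex rfl rfl
        omega
    · exact hsub _ q k p hp hq hk hs
  | true =>
    exact dfs_sound hp (fun q => hprune _ q rfl) S (fun q k hq hk => hsub _ q k p hp hq hk hs) _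
      hl h1 hz hS'

theorem node_noDiag {ex : Bool} {w r g : ℕ} {sub : Bool → Pos → ℕ → Bool}
    (h : node ex w r g sub = true) : noDiag r = true ∧ noDiag g = true := by
  simp only [node, Bool.and_eq_true] at h
  exact ⟨h.1, h.2.1⟩

theorem Approx.close {K : ℕ → ℕ → Prop} {r g : ℕ} (h : Approx K r g) :
    Approx K (Nat.lor r (spread r)) g where
  cand i hi h0 := by
    rw [testBit_lor, Bool.or_eq_true] at hi
    exact hi.elim (fun hi => h.cand i hi h0) fun hi => (h.spread_cand hi).2
  arc i hi h0 := by
    rw [testBit_lor, Bool.or_eq_true] at hi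
    exact hi.elim (fun hi => h.arc i hi h0) fun hi => absurd (h.spread_cand hi).1 h0
  sym := h.sym
  lt := h.lt

theorem refute_succ_sound {w r g : ℕ} (h : refute (w + 1) r g = true)
    (ih : ∀ K r g, Approx K r g → refute w (Nat.lor r (spread r)) g = true → ¬ Solv K w) :
    ¬ Solv (rel r g) (w + 1) := by
  intro hs
  obtain ⟨p, d, hp, hd, hs⟩ := hs.normalize
  have h' : node false w r g (fun d q _ => some3 fun o => kid r g d q o fun r' g' =>
      Coins.close r' fun r' => force g' fun g' => refute w r' g') = true := h
  obtain ⟨hr, hg⟩ := node_noDiag h'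
  have hd' : ∃ d', d = off d' := by
    rcases hd with rfl | rfl
    exacts [⟨false, rfl⟩, ⟨true, rfl⟩]
  obtain ⟨d, rfl⟩ := hd'
  refine node_sound h' (fun d q _ p _ hq hk hs => ?_) p hp d (by simp) hs
  obtain ⟨o, hk⟩ := some3_eq_true.1 hk
  simp only [kid, Coins.close, force_eq] at hk
  exact ih _ _ _ (approx_kid hr hg hq d o) hk (hs o)

theorem Approx.refute_sound {w : ℕ} {K : ℕ → ℕ → Prop} {r g : ℕ} (h : Approx K r g)
    (hq : refute w (Nat.lor r (spread r)) g = true) : ¬ Solv K w := by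
  induction w generalizing K r g with
  | zero => exact quick_sound h.close hq
  | succ w ih =>
    exact fun hs => refute_succ_sound hq (fun K r g h hq => ih h hq) (h.solv_rel hs)

theorem refute_sound {w r g : ℕ} (h : refute (w + 1) r g = true) : ¬ Solv (rel r g) (w + 1) :=
  refute_succ_sound h fun _ _ _ h hq => h.refute_sound hq

/-- States, given by two matrices, that cannot be resolved in two weighings. -/
def cores : List (ℕ × ℕ) :=
  [(36346632615344003116557904207478841, 110682153317891047480),
   (39895751116891787410210941, 38686806823229595166834716),
   (295965437482138458390399234736717881, 110682153317891047480),
   (5149986517348260680396376310013, 5070757143528510431839066390588),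
   (7685287717694002989600742244477, 7606058346235472011825036001308),
   (7685362672828814728439664934925, 7606097033042292989577437249548),
   (2614760270624632355728477716505, 2535301203260374598409583591448),
   (276705383466521002045, 258258357913539706940),
   (337504446158793301986223099412677117, 332312070070887015826712697047220236),
   (343641805252683541589048479122235916313, 664634280340748394943305204024999960),
   (20004149905435859793680341199122216615602094201,
    17127320766932165202884027856079191833398738968),
   (5222641785168093417147599091728409, 5070757143860560832502529785880),
   (22682207552421458864337626821970806504095853, 7606058346235473700726435348492),
   (1498084872861668906328809938675959562999886284783661,
    1496623348553011843591047474600891140966144596377612),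
   (87455398129705437923768725321278688395297, 87115110547589716684293666549854980014112)]

/-- Embeddings of the states `cores` into children of states arising after the first weighing: the
bits from `54` on encode the placement, bits `52` and `53` the outcome, bits `48` to `51` the index
of the core, and the lower bits the embedding. -/
def hints : List ℕ :=
  [3192228144707858993338, 3339226199482586763450, 3339802660234890186938, 3929526268312831620692,
   3930102729065135044180, 3932264439294087886420, 4928527930633171898554, 5555717792089250074810,
   6290421261779317519956, 6290565394559578371668, 6291141856411392374356, 10243357318113936168071,
   10280204888668435622160, 12010348250411610908944, 12046671210834000493474,
   12193668702671405923234, 12194092356751554252969, 12194245163423709346722,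
   12636380183478613971096, 12636822643496325370998, 12636966776276570494070,
   12784396596086001792101, 13374691562028459521620, 14217039957452844149008,
   14225683884940381657472, 14262439143269330867318, 14370957567740940237328,
   14373112311390447245328, 14373263389814704902330, 14373837334855647209744,
   14407277991516519676834, 14407701645596700446889, 14407854452268823100322,
   14409969699273933756432, 14410018617439609383576, 14410160295278036794274,
   14554699137434207229984, 14555275598186376859817, 14555428404858531953570,
   14557554853542127830885, 14557590882339146794853, 14557734247867745647522,
   14961102278739939203088, 14963408121749152897040, 14997429424178844554358,
   14997573556959089677430, 14998005884931147977846, 15000265509632639408144,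
   15145002532347978151508, 15735154227522902849108, 15735298342710978704980,
   15735838793353663837780, 19097785766831809652035, 19134642044049020397840,
   19687513823100923171975, 23624880052969395693840, 23633523362532252981632,
   23661200965894234871858, 23661772923192134576400, 23668111007670458390912,
   23670271324540061259792, 23670424337931089647666, 23670996295228989352208,
   23704866844209600157540, 23707128712423547770896, 23707173710890432895026,
   23707317826078508750898, 23815539434120523978768, 23815692500287019002162,
   23851866842067734248354, 23852396822004010489872, 23852441873246362249522,
   23852585988434438105394, 23999404765860424137634, 23999979797039019698482,
   24000015825836038662450, 24405835244479229630480, 24442116171610412718096,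
   24442162407510304248950, 24589551146882478807090, 25179851164465174312532,
   47422905125704039884099, 47423490234864045369633, 47431552318485453366595,
   47432137785044923147655, 48021712720323088372871, 48058571324682072836214,
   49678026002235079161428, 49788708178266458104250, 49825016236077070028952,
   49825601666413877207482, 49972599158251250196922, 49973175619003553620410,
   50379003988831035924922, 50415754506462075901046, 50563328459051752322149,
   51153046964233586177620, 51153623424985889601108, 51967731508708291885601,
   51995392094106174387796, 52002319136254328027681, 52004624996855710988833,
   52038633363391018325860, 52039212625501257710113, 52140668047664425935290,
   52149305989351874891928, 52149746416605738838673, 52149891419701280711098,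
   52152051774243401769368, 52186057047801692461089, 52186208447096396390842,
   52186639872673524165265, 52333594971594349910049, 52333631000391368874017,
   52333782399686072803770, 52334213860443260922513, 52739457684522504687768,
   52739601799710580543640, 52776325239234847462518, 52776361287144595084406,
   52776901735171521860726, 52923899191824523883621, 52924475687761198281829,
   53514086090480332928596, 53514194194459011544660, 53514770656310825547348,
   56867061630691168445763, 56867493976255254455619, 56867638091443330311491,
   56868223200603335797025, 56876141169036667938115, 56876285284224743793987,
   56876681598702325425475, 56876717627499344389443, 57466301570874302944391,
   57466409674853109355655, 61410158613846199351841, 61437819217253256689236,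
   61446466409875316676992, 61446907986805408871081, 61447052101993618455073,
   61449176056903156537394, 61483762114388997338708, 61483801476052338553513,
   61483945591240548137505, 61486069545050575640626, 61585256876019250080050,
   61593901873260937975858, 61594047924688267715002, 61594444219259085891890,
   61594480248056104855858, 61630762676227876993954, 61630798705024895957922,
   61630941412835686818234, 61631337707406504995122, 61778336628817585847202,
   61778372657614604811170, 61778911659996181408050, 62184740032916040165682,
   62220908422833097054258, 62221058241670446994550, 62368483010182902356018,
   62958783027422336022100, 94508047280136520444193, 94508083308933539408161,
   94508227424121615264033, 94645849378460254299459, 94645993493648330155331,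
   94646433942262632917281, 94646578057450708773153, 94647154518203012196641,
   94655037000907183711555, 94655073029704202675523, 94655226152989071861127,
   99171209836353407710804, 99372795177444102578584, 198391066746766814744762,
   198399713658051366097082, 198538640702654739779770, 198547135655126024348995,
   198583883899914146681001, 199174143681475833368745, 200756861677591325708474,
   200793169735316040454296, 200793755165738744811706, 200940599572717641011352,
   201088184765674255615845, 201530895383076346663064, 203117459488590845317272,
   203154216171299420001398, 203154361946421263995066, 203264889325992445874328,
   203265473384373604755728, 203301795724428503114256, 203449368007109078222693,
   203855185136351151526040, 204629777513507397531220, 207835648601488896779587,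
   207835799712506105172154, 207844446623790656524474, 207981067825384816513210,
   207982644967331739428163, 207982797207641726783674, 207983226492164258470544,
   207991724505677238920515, 207991868620865314776387, 208581992993901495342215,
   212525300373556544412032, 212525741950486888264361, 212552978051976280543418,
   212553402553893827671636, 212562049746515887659392, 212562201424013135319226,
   212562635438634307367593, 212599094912160554422458, 212709482676419551729714,
   212709629325093863004210, 212746526156853542796194, 212894100109443251649442,
   213336672538239276062770, 245587063131781595314704, 245614551359928312506657,
   245614587388725331470625, 245623378486747818234042, 245759855551082066061601,
   245761540801491882173763, 245761576830288901137731, 245761729070598888493242,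
   245762125365294260791585, 245770773460832623879559, 250295012523570717991320,
   250331761333529131295128, 250331905448717207151000, 250341128820754061926808,
   250488558658292816224664, 396877276940292600238266, 396877312969089619202234,
   396877456522427535331514]

/-- Does the injection encoded by `φ` embed the state given by `cr` and `cg` into the one given
by `r`? -/
def embeds (cr cg φ r : ℕ) : Bool :=
  (List.range 12).all fun f => force (Nat.land (Nat.shiftRight φ (Nat.mul 4 f)) 15) fun f' =>
    Nat.blt f' 12 && ((!bit cr (16 * f) || bit r (16 * f')) &&
    (List.range 12).all fun c => Nat.beq f c ||
      force (Nat.land (Nat.shiftRight φ (Nat.mul 4 c)) 15) fun c' =>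
      !Nat.beq f' c' &&
      (!(bit cr (16 * f + (c + 1)) || (bit cg (16 * f + (c + 1)) || bit cg (16 * c + (f + 1)))) ||
        bit r (16 * f' + (c' + 1))))

/-- The outcome encoded by a number. -/
def outcome (t : ℕ) : Ordering := cond (Nat.beq t 0) .gt (cond (Nat.beq t 1) .eq .lt)

/-- Is there a hint showing that the placement `q` with index `k` is of no use? -/
def hinted (r g : ℕ) (d : Bool) (q : Pos) (k : ℕ) : Bool :=
  force (Nat.add (Nat.mul 2 k) (cond d 1 0)) fun k => hints.any fun h =>
    Nat.beq (Nat.shiftRight h 54) k &&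
    kid r g d q (outcome (Nat.land (Nat.shiftRight h 52) 3)) fun r' _ => close r' fun r' =>
      match cores[Nat.land (Nat.shiftRight h 48) 15]? with
      | none => false
      | some x => force (Nat.land h 281474976710655) fun φ => embeds x.1 x.2 φ r'

/-- The initial state for twelve coins. -/
def full : ℕ × ℕ :=
  (392232055654753607330082043838030361313729652836099891197,
   392136273221925550860045639024980728805663697919727509500)

/-- The states after the first weighing when it balances, with three, four or five coins on each
pan. -/
def balanced : List (ℕ × ℕ) :=
  [(1436736492423455015729783025783177022625639278722489345,
    1340954059592954600442506969346003360540730536469994496),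
   (2969255417669750612169099944786813269998382077202996737,
    2873472984841694102099475493979714474293855001059008000),
   (6034293268167557612294137057175885184107481922610994945,
    5938510835339501142257098567613474884591649702423830272)]

/-- The search through the first weighing; it is of no use if it might lead to a state in
`balanced`. -/
def root : Bool :=
  node true 3 full.1 full.2 fun d q _ => !d && kid full.1 full.2 false q .eq fun r g =>
    close r fun r => balanced.any fun x => Nat.beq r x.1 && Nat.beq g x.2

theorem root_eq : root = true := by decide +kernel

theorem refute_cores : (cores.all fun x => refute 2 x.1 x.2) = true := by decide +kernel

theorem embeds_sound {cr cg φ r g w : ℕ} (h : embeds cr cg φ r = true) (hs : Solv (rel r g) w) :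
    Solv (rel cr cg) w := by
  obtain ⟨ψ, hψ⟩ : ∃ ψ : ℕ → ℕ, ∀ x, Nat.land (Nat.shiftRight φ (Nat.mul 4 x)) 15 = ψ x :=
    ⟨_, fun _ => rfl⟩
  simp only [embeds, force_eq, hψ, bit_eq, List.all_eq_true, List.mem_range, Bool.and_eq_true,
    Bool.or_eq_true, Nat.blt_eq, Nat.beq_eq, Bool.not_eq_true'] at h
  have harc : ∀ f c, f ≠ c → rel cr cg f c → ψ f ≠ ψ c ∧ rel r g (ψ f) (ψ c) := by
    rintro f c hne ⟨hf, hc, hb⟩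
    obtain ⟨h1, -, h2⟩ := h f hf
    obtain ⟨h3, h4⟩ := (h2 c hc).resolve_left hne
    have hne' : ψ f ≠ ψ c := fun e => by simp [e, Nat.beq_refl] at h3
    refine ⟨hne', h1, (h c hc).1, ?_⟩
    rw [if_neg hne] at hb
    rw [if_neg hne']
    refine Or.inl (h4.resolve_left fun hn => ?_)
    simp only [Bool.or_eq_false_iff] at hn
    simp [hn] at hb
  have hcand : ∀ f c, rel cr cg f c → ∃ c', rel r g (ψ f) c' := fun f c hfc => by
    by_cases e : f = c
    · obtain ⟨hf, -, hb⟩ := hfc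
      rw [if_pos e] at hb
      obtain ⟨h1, h2, -⟩ := h f hf
      refine ⟨ψ f, h1, h1, ?_⟩
      rw [if_pos rfl]
      exact h2.resolve_left (by simp [hb])
    · exact ⟨_, (harc f c e hfc).2⟩
  refine hs.embed ψ {x | x < 12} (fun f hf c hc e => ?_) (fun f c hfc => ⟨hfc.1, hfc.2.1⟩)
    (fun f c hne hfc => (harc f c hne hfc).2) hcand
  by_contra hne
  have := ((h f hf).2.2 c hc).resolve_left hne
  simp [e, Nat.beq_refl] at this

theorem hinted_sound {r g k : ℕ} {d : Bool} {q : Pos} {p : ℕ → ℤ} (hr : noDiag r = true)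
    (hg : noDiag g = true) (hq : Cons q p) (h : hinted r g d q k = true) :
    ¬ ∀ o, Solv (step (rel r g) p (off d) o) 2 := by
  intro hs
  simp only [hinted, force_eq, List.any_eq_true, Bool.and_eq_true, kid, close] at h
  obtain ⟨t, -, -, h⟩ := h
  have hs' := (approx_kid hr hg hq d _).solv_rel
    (hs (outcome (Nat.land (Nat.shiftRight t 52) 3)))
  split at h
  · cases h
  · rename_i x hx
    exact refute_sound (List.all_eq_true.1 refute_cores x (List.mem_of_getElem? hx))
      (embeds_sound h hs')

/-- Is the second weighing from the state `x` hopeless? -/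
def settled (x : ℕ × ℕ) : Bool :=
  force x.1 fun r => force x.2 fun g => node false 2 r g (hinted r g)

theorem exists_off {d : ℤ} (h : d = 0 ∨ d = 1) : ∃ d', d = off d' := by
  rcases h with rfl | rfl
  exacts [⟨false, rfl⟩, ⟨true, rfl⟩]

theorem settled_sound {x : ℕ × ℕ} (h : settled x = true) : ¬ Solv (rel x.1 x.2) 3 := by
  intro hs
  rw [settled, force_eq, force_eq] at h
  obtain ⟨p, d, hp, hd, hs⟩ := hs.normalize
  obtain ⟨hr, hg⟩ := node_noDiag h
  obtain ⟨d, rfl⟩ := exists_off hd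
  exact node_sound h (fun d q k p _ hq hk => hinted_sound hr hg hq hk) p hp d (by simp) hs

theorem settled_zero : settled balanced[0] = true := by decide +kernel

theorem settled_one : settled balanced[1] = true := by decide +kernel

theorem settled_two : settled balanced[2] = true := by decide +kernel

theorem settled_of_mem {x : ℕ × ℕ} (h : x ∈ balanced) : settled x = true := by
  rw [show balanced = [balanced[0], balanced[1], balanced[2]] from rfl] at h
  simp only [List.mem_cons, List.not_mem_nil, or_false] at h
  rcases h with rfl | rfl | rfl
  exacts [settled_zero, settled_one, settled_two]

theorem coins_full : (coins full.1).toFinset = Finset.range 12 := by decide +kernel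

theorem root_sound {p : ℕ → ℤ} (hp : IsPos p) (d : Bool)
    (h0 : d = false → ∑ i ∈ Finset.range 12, p i = 0) :
    ¬ ∀ o, Solv (step (rel full.1 full.2) p (off d) o) 3 := by
  obtain ⟨hr, hg⟩ := node_noDiag root_eq
  refine node_sound root_eq (fun d q _ p _ hq hk hs => ?_) p hp d fun _ => coins_full ▸ h0
  simp only [Bool.and_eq_true, Bool.not_eq_true', kid, close, force_eq, List.any_eq_true,
    Nat.beq_eq] at hk
  obtain ⟨rfl, x, hx, h1, h2⟩ := hk
  have := (approx_kid hr hg hq false .eq).solv_rel (hs .eq)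
  rw [h1, h2] at this
  exact settled_sound (settled_of_mem hx) this

theorem full_contradiction {p : ℕ → ℤ} {d : ℤ} (hp : IsPos p)
    (h0 : d = 0 → ∑ i ∈ Finset.range 12, p i = 0) :
    ¬ ∀ o, Solv (step (rel full.1 full.2) p d o) 3 := by
  intro h
  obtain ⟨p', d', hp', hd, h'⟩ := exists_normalized hp h
  rcases hd with ⟨rfl, hd⟩ | rfl
  · refine root_sound hp' false (fun _ => ?_) h'
    rcases hd with rfl | ⟨h1, rfl⟩
    exacts [by simp, h0 h1]
  · exact root_sound hp' true (by simp) h'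

/-- The pairs of distinct coins among the first `N`. -/
def pairs (N f c : ℕ) : Prop := f < N ∧ c < N ∧ f ≠ c

/-- The placements of fake coin and chameleon that are treated correctly by a strategy. -/
def Handled {N : ℕ} (t : FCTree N) (f c : ℕ) : Prop :=
  ∃ (hf : f < N) (hc : c < N), f ≠ c ∧ ∀ S, Reaches ⟨f, hf⟩ ⟨c, hc⟩ t S → S.card ≤ 2 ∧ ⟨f, hf⟩ ∈ S

/-- The placement of the coins on the pans `A` and `B`. -/
def panPos {N : ℕ} (A B : Finset (Fin N)) (i : ℕ) : ℤ :=
  if ∃ h : i < N, (⟨i, h⟩ : Fin N) ∈ A then 1 else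
    if ∃ h : i < N, (⟨i, h⟩ : Fin N) ∈ B then -1 else 0

theorem isPos_panPos {N : ℕ} (A B : Finset (Fin N)) : IsPos (panPos A B) := fun i => by
  unfold panPos
  split_ifs <;> simp

theorem panPos_val {N : ℕ} (A B : Finset (Fin N)) (x : Fin N) :
    panPos A B x = if x ∈ A then 1 else if x ∈ B then -1 else 0 := by
  simp [panPos]

theorem sum_panPos {N : ℕ} {A B : Finset (Fin N)} (h : Disjoint A B) :
    ∑ i ∈ Finset.range N, panPos A B i = (A.card : ℤ) - B.card := by
  rw [Finset.sum_range]
  have : ∀ x : Fin N, panPos A B x = (if x ∈ A then 1 else 0) - if x ∈ B then 1 else 0 := by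
    intro x
    have : x ∈ A → x ∉ B := fun hx => Finset.disjoint_left.1 h hx
    rw [panPos_val]
    split_ifs <;> simp_all
  simp [this]

theorem sum_coinWeight {N : ℕ} {f c : Fin N} (hfc : f ≠ c) (b : Bool) (A : Finset (Fin N)) :
    ((∑ x ∈ A, coinWeight f c b x : ℕ) : ℤ) =
      A.card - (if f ∈ A then 1 else 0) - if b = true ∧ c ∈ A then 1 else 0 := by
  have : ∀ x : Fin N, ((coinWeight f c b x : ℕ) : ℤ) =
      1 - (if x = f then 1 else 0) - if x = c then (if b then 1 else 0) else 0 := by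
    intro x
    unfold coinWeight
    split_ifs <;> simp_all
  push_cast
  simp only [this, Finset.sum_sub_distrib, Finset.sum_ite_eq']
  cases b <;> simp

theorem weighOutcome_eq {N : ℕ} {f c : Fin N} (hfc : f ≠ c) (b : Bool) {A B : Finset (Fin N)}
    (h : Disjoint A B) : weighOutcome f c b A B =
      compare ((A.card : ℤ) - B.card) (panPos A B f + if b then panPos A B c else 0) := by
  have hf : f ∈ A → f ∉ B := fun hx => Finset.disjoint_left.1 h hx
  have hc : c ∈ A → c ∉ B := fun hx => Finset.disjoint_left.1 h hx
  have key : ∀ (a b : ℕ) (u v : ℤ), (a : ℤ) - b = u - v → compare a b = compare u v := by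
    intro a b u v huv
    rcases lt_trichotomy a b with h | h | h
    · rw [compare_lt_iff_lt.2 h, compare_lt_iff_lt.2 (by omega)]
    · rw [compare_eq_iff_eq.2 h, compare_eq_iff_eq.2 (by omega)]
    · rw [compare_gt_iff_gt.2 h, compare_gt_iff_gt.2 (by omega)]
  refine key _ _ _ _ ?_
  rw [sum_coinWeight hfc, sum_coinWeight hfc, panPos_val, panPos_val]
  cases b <;> split_ifs <;> simp_all <;> omega

theorem Handled.child {N : ℕ} {A B : Finset (Fin N)} {child : Ordering → FCTree N} {f c : ℕ}
    (h : Handled (.weigh A B child) f c) (hAB : Disjoint A B) (b : Bool) :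
    Handled (child (compare ((A.card : ℤ) - B.card)
      (panPos A B f + if b then panPos A B c else 0))) f c := by
  obtain ⟨hf, hc, hne, h⟩ := h
  refine ⟨hf, hc, hne, fun S hS => h S (.weigh A B child b S ?_)⟩
  rw [weighOutcome_eq (by simpa using hne) b hAB]
  exact hS

theorem Handled.step {N : ℕ} {A B : Finset (Fin N)} {child : Ordering → FCTree N} {w : ℕ}
    (hAB : Disjoint A B) {o : Ordering} (h : Solv (Handled (child o)) w) :
    Solv (step (Handled (.weigh A B child)) (panPos A B) ((A.card : ℤ) - B.card) o) w := by
  refine h.sub (fun f c hne hfc => ?_) fun f c hfc => ?_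
  · rw [Coins.step, if_neg hne] at hfc
    obtain ⟨hfc, rfl | rfl⟩ := hfc
    · simpa using hfc.child hAB false
    · simpa using hfc.child hAB true
  · unfold Coins.step at hfc
    split_ifs at hfc
    · obtain ⟨⟨c', h'⟩, rfl⟩ := hfc
      exact ⟨c', by simpa using h'.child hAB false⟩
    · obtain ⟨hfc, rfl | rfl⟩ := hfc
      · exact ⟨c, by simpa using hfc.child hAB false⟩
      · exact ⟨c, by simpa using hfc.child hAB true⟩

theorem solv_handled {N : ℕ} {t : FCTree N} {w : ℕ} (ht : t.WF) (hw : t.depth ≤ w) :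
    Solv (Handled t) w := by
  induction w generalizing t with
  | zero =>
    cases t with
    | output S =>
      have hS : ∀ f c, Handled (.output S) f c → S.card ≤ 2 ∧ f ∈ S.image Fin.val := by
        rintro f c ⟨hf, hc, hne, h⟩
        have := h S (.output S)
        exact ⟨this.1, Finset.mem_image.2 ⟨_, this.2, rfl⟩⟩
      by_cases h2 : S.card ≤ 2
      · exact ⟨_, Finset.card_image_le.trans h2, fun f c h => (hS f c h).2⟩
      · exact ⟨∅, by simp, fun f c h => absurd (hS f c h).1 h2⟩
    | weigh A B child =>
      rw [FCTree.depth] at hw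
      omega
  | succ w ih =>
    cases t with
    | output S => exact (ih ht (Nat.zero_le _)).succ
    | weigh A B child =>
      refine ⟨_, _, isPos_panPos A B, fun o => Handled.step ht.1 (ih (ht.2 o) ?_)⟩
      rw [FCTree.depth] at hw
      cases o <;> omega

theorem exists_first_weighing {N w : ℕ} (h : FCAlgorithm N (w + 1)) :
    ∃ p d, IsPos p ∧ ∑ i ∈ Finset.range N, p i = d ∧ ∀ o, Solv (step (pairs N) p d o) w := by
  obtain ⟨t, ht, hw, h⟩ := h
  have hK : ∀ f c, pairs N f c → Handled t f c := fun f c ⟨hf, hc, hne⟩ =>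
    ⟨hf, hc, hne, h ⟨f, hf⟩ ⟨c, hc⟩ (by simpa using hne)⟩
  cases t with
  | output S =>
    refine ⟨fun _ => 0, 0, fun _ => by simp, by simp, Solv.idle ?_⟩
    exact (solv_handled ht (Nat.zero_le _)).mono hK
  | weigh A B child =>
    refine ⟨panPos A B, _, isPos_panPos A B, sum_panPos ht.1, fun o => ?_⟩
    rw [FCTree.depth] at hw
    have hs := Handled.step ht.1 (solv_handled (w := w) (ht.2 o) (by cases o <;> omega))
    refine hs.mono fun f c hfc => ?_
    unfold step at hfc ⊢
    split_ifs at hfc ⊢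
    · exact ⟨hfc.1.imp fun c' => hK f c', hfc.2⟩
    · exact ⟨hK _ _ hfc.1, hfc.2⟩

theorem card_contradiction {N : ℕ} (hN : 14 ≤ N) : ¬ Solv (pairs N) 4 := by
  intro h
  let E := (Finset.range 224).filter fun i => i % 16 ≠ 0 ∧ i % 16 ≤ 14 ∧ i / 16 ≠ i % 16 - 1
  have hE : ∀ i ∈ E, i < 224 ∧ i % 16 ≠ 0 ∧ i % 16 ≤ 14 ∧ i / 16 ≠ i % 16 - 1 := by
    simp [E]
  have := h.card_le E (fun i hi => ?_) fun i hi j _ h0 => absurd h0 (hE i hi).2.1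
  · have hc : E.card = 182 := by decide +kernel
    omega
  · obtain ⟨h1, h2, h3, h4⟩ := hE i hi
    rw [Good, if_neg h2]
    exact ⟨h4, ⟨by omega, by omega, h4⟩, by omega, by omega, h4.symm⟩

theorem not_fcAlgorithm {N : ℕ} (hN : 11 < N) : ¬ FCAlgorithm N 4 := by
  intro h
  obtain ⟨p, d, hp, hsum, h⟩ := exists_first_weighing h
  by_cases h14 : 14 ≤ N
  · exact card_contradiction h14 ⟨p, d, hp, h⟩
  obtain ⟨σ, hσ, hz⟩ : ∃ σ : Equiv.Perm ℕ, (∀ i < 12, σ i < N) ∧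
      (d = 0 → ∑ i ∈ Finset.range 12, p (σ i) = 0) := by
    obtain rfl | rfl : N = 12 ∨ N = 13 := by omega
    · exact ⟨1, by simp, by simp [hsum]⟩
    by_cases hd : d = 0
    · obtain ⟨a, ha, h0⟩ : ∃ a < 13, p a = 0 := by
        by_contra! hcon
        have h2 : ∀ i ∈ Finset.range 13, p i % 2 = 1 := fun i hi => by
          have := hcon i (Finset.mem_range.1 hi)
          rcases hp i with h | h | h <;> omega
        have h3 := Finset.sum_int_mod (Finset.range 13) 2 p
        rw [Finset.sum_congr rfl h2, hsum, hd] at h3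
        norm_num at h3
      refine ⟨Equiv.swap a 12, fun i hi => ?_, fun _ => ?_⟩
      · rw [Equiv.swap_apply_def]
        split_ifs <;> omega
      · have h1 : ∑ i ∈ Finset.range 13, p (Equiv.swap a 12 i) = ∑ i ∈ Finset.range 13, p i := by
          refine Finset.sum_equiv (Equiv.swap a 12) (fun i => ?_) fun i _ => rfl
          rw [Finset.mem_range, Finset.mem_range, Equiv.swap_apply_def]
          split_ifs <;> omega
        rw [Finset.sum_range_succ, Equiv.swap_apply_right, h0, hsum, hd, add_zero] at h1
        exact h1
    · exact ⟨1, fun i hi => by simp; omega, fun h => absurd h hd⟩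
  refine full_contradiction (p := p ∘ σ) (d := d) (fun i => hp _) hz fun o => ?_
  have hcand : ∀ f < 12, ∃ c, pairs N (σ f) c := fun f hf =>
    ⟨σ (if f = 0 then 1 else 0), hσ f hf, hσ _ (by split_ifs <;> omega), fun e => by
      have := σ.injective e
      split_ifs at this <;> omega⟩
  refine (h o).embed σ Set.univ σ.injective.injOn (by simp) (fun f c hne hfc => ?_)
    fun f c hfc => ?_
  · rw [step, if_neg hne] at hfc
    rw [step, if_neg (σ.injective.ne hne)]
    exact ⟨⟨hσ f hfc.1.1, hσ c hfc.1.2.1, σ.injective.ne hne⟩, hfc.2⟩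
  · unfold step at hfc
    split_ifs at hfc with e
    · refine ⟨σ f, ?_⟩
      rw [step, if_pos rfl]
      exact ⟨hcand f hfc.1.choose_spec.1, hfc.2⟩
    · refine ⟨σ c, ?_⟩
      rw [step, if_neg (σ.injective.ne e)]
      exact ⟨⟨hσ f hfc.1.1, hσ c hfc.1.2.1, σ.injective.ne e⟩, hfc.2⟩

/-- The three continuations after a weighing: left pan lighter, balance, right pan lighter. -/
def branch {N : ℕ} (l e r : FCTree N) : Ordering → FCTree N
  | .lt => l
  | .eq => e
  | .gt => r

/-- Whether the placement of the fake coin `f` and the chameleon `c` is treated correctly. -/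
def treats {N : ℕ} (f c : Fin N) : FCTree N → Bool
  | .output S => decide (S.card ≤ 2) && decide (f ∈ S)
  | .weigh A B child =>
    treats f c (child (weighOutcome f c true A B)) &&
      treats f c (child (weighOutcome f c false A B))

/-- Whether the pans of every weighing are disjoint. -/
def separates {N : ℕ} : FCTree N → Bool
  | .output _ => true
  | .weigh A B child =>
    decide (Disjoint A B) &&
      (separates (child .lt) && (separates (child .eq) && separates (child .gt)))

theorem treats_sound {N : ℕ} {f c : Fin N} {t : FCTree N} {S : Finset (Fin N)}
    (hS : Reaches f c t S) (h : treats f c t = true) : S.card ≤ 2 ∧ f ∈ S := by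
  induction hS with
  | output S => simpa [treats] using h
  | weigh A B child b S _ ih =>
    simp only [treats, Bool.and_eq_true] at h
    cases b
    exacts [ih h.2, ih h.1]

theorem separates_sound {N : ℕ} {t : FCTree N} (h : separates t = true) : t.WF := by
  induction t with
  | output S => trivial
  | weigh A B child ih =>
    simp only [separates, Bool.and_eq_true, decide_eq_true_eq] at h
    refine ⟨h.1, fun o => ih o ?_⟩
    cases o
    exacts [h.2.1, h.2.2.1, h.2.2.2]

/-- A strategy for eleven coins. -/
def strategy : FCTree 11 :=
  .weigh {7, 8, 9, 10} {0, 1, 2, 3} (branch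
    (.weigh {3, 5, 6, 10} {0, 1, 2, 7} (branch
      (.weigh {2, 7, 9} {0, 1, 8} (branch
        (.weigh {0, 1, 6} {2, 3, 10} (branch
          (.output {6, 9})
          (.output {5, 9})
          (.output {9, 10})))
        (.weigh {2, 3, 6} {0, 1, 4} (branch
          (.output {6, 10})
          (.output {5, 10})
          (.output {4, 10})))
        (.weigh {2, 4, 6, 7} {0, 1, 3, 10} (branch
          (.output {6, 8})
          (.output {5, 8})
          (.output {8, 10})))))
      (.weigh {3, 6, 8, 9} {0, 1, 4, 10} (branch
        (.weigh {3, 5, 6, 7, 10} {0, 1, 2, 8, 9} (branch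
          (.output {6, 7})
          (.output {8, 9})
          (.output {8, 9})))
        (.weigh {2, 9} {5, 7} (branch
          (.output {4, 9})
          (.output {4, 8})
          (.output {5, 7})))
        (.weigh {3, 5, 6, 7, 10} {0, 1, 2, 4, 8} (branch
          (.output {7, 10})
          (.output {4, 10})
          (.output {4})))))
      (.weigh {4, 7, 8, 9, 10} {0, 1, 2, 3, 5} (branch
        (.weigh {6, 9, 10} {3, 4, 5} (branch
          (.output {7, 9})
          (.output {7, 8})
          (.output {4, 7})))
        (.weigh {4, 6, 8, 9, 10} {0, 1, 2, 3, 7} (branch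
          (.output {8, 9})
          (.output {8, 9})
          (.output {7})))
        (.output ∅)))))
    (.weigh {3, 6, 10} {0, 1, 4} (branch
      (.weigh {4, 7, 8, 9} {0, 1, 2, 6} (branch
        (.weigh {9} {7} (branch
          (.output {3, 9})
          (.output {3, 8})
          (.output {3, 7})))
        (.weigh {5, 6, 7, 8, 9} {0, 1, 2, 3, 10} (branch
          (.output {5, 6})
          (.output {3, 5})
          (.output {3, 10})))
        (.weigh {5, 6, 7, 8, 9} {0, 1, 2, 3, 4} (branch
          (.output {5, 6})
          (.output {6, 10})
          (.output {2, 10})))))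
      (.weigh {7, 8, 9} {4, 5, 6} (branch
        (.weigh {9} {7} (branch
          (.output {2, 9})
          (.output {2, 8})
          (.output {2, 7})))
        (.weigh {2, 5} {0, 3} (branch
          (.output {2, 5})
          (.output {1, 10})
          (.output {0, 10})))
        (.weigh {3, 4, 6, 9, 10} {0, 1, 2, 5, 7} (branch
          (.output {4, 6})
          (.output {5, 6})
          (.output {5})))))
      (.weigh {4, 5, 9, 10} {0, 2, 3, 7} (branch
        (.weigh {4, 5, 6, 7, 8} {0, 1, 2, 3, 9} (branch
          (.output {4, 5})
          (.output {4, 5})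
          (.output {1, 9})))
        (.weigh {4, 5} {1, 8} (branch
          (.output {4, 5})
          (.output {0, 9})
          (.output {1, 8})))
        (.weigh {1, 2, 3, 7} {0, 8, 9, 10} (branch
          (.output {1, 7})
          (.output {0, 7})
          (.output {0, 8})))))))
    (.weigh {4, 5, 6, 10} {0, 1, 7, 8} (branch
      (.weigh {6, 7, 8, 9} {0, 1, 2, 4} (branch
        (.output {3, 6})
        (.weigh {3, 5, 7, 8, 9} {0, 1, 2, 4, 6} (branch
          (.output {3, 5})
          (.output {3, 5})
          (.output {2, 6})))
        (.weigh {3, 4, 7, 8, 9} {0, 1, 2, 5, 6} (branch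
          (.output {3, 4})
          (.output {2, 4})
          (.output {2, 5})))))
      (.weigh {2, 3, 6, 10} {0, 4, 7, 8} (branch
        (.weigh {2, 3, 7, 8, 9} {0, 1, 4, 5, 6} (branch
          (.output {2, 3})
          (.output {2, 3})
          (.output {1, 6})))
        (.weigh {2, 3} {1, 5} (branch
          (.output {2, 3})
          (.output {0, 6})
          (.output {1, 5})))
        (.weigh {1, 2, 3, 4} {0, 5, 6, 10} (branch
          (.output {1, 4})
          (.output {0, 4})
          (.output {0, 5})))))
      (.weigh {7, 8, 9, 10} {0, 4, 5, 6} (branch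
        (.weigh {0, 4, 5, 6} {1, 2, 9, 10} (branch
          (.output ∅)
          (.output {3})
          (.output {1, 2})))
        (.weigh {3, 6} {2, 4} (branch
          (.output {1, 3})
          (.output {0, 1})
          (.output {1, 2})))
        (.weigh {3, 8, 9, 10} {1, 4, 5, 6} (branch
          (.output {0, 3})
          (.output {0, 2})
          (.output {0, 1}))))))))

theorem fcAlgorithm_eleven : FCAlgorithm 11 4 := by
  have h : ∀ f c : Fin 11, f ≠ c → treats f c strategy = true := by decide +kernel
  exact ⟨strategy, separates_sound (by decide +kernel), by decide +kernel,
    fun f c hfc S hS => treats_sound hS (h f c hfc)⟩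

end Coins

/-- N(4) = 11: there is an FC-algorithm in 4 weighings for 11 coins, and no
FC-algorithm in 4 weighings exists for more than 11 coins. -/
theorem fc_N_four_eq_eleven :
    FCAlgorithm 11 4 ∧ ∀ N : ℕ, 11 < N → ¬ FCAlgorithm N 4 := by
  exact ⟨Coins.fcAlgorithm_eleven, fun _ => Coins.not_fcAlgorithm⟩
end

section
/- For every integer k ≥ 0, N(6+2k) ≥ 36·3^k; that is, there exists an FC-algorithm in 6+2k weighings for 36·3^k coins. -/
open Finset

/-- The contribution of a coin `x` to the lightness of a pan `A`. -/
def panInd {N : ℕ} (A : Finset (Fin N)) (x : Fin N) : ℕ := if x ∈ A then 1 else 0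

/-- The number of light coins on the pan `A`. -/
def lightCount {N : ℕ} (f c : Fin N) (b : Bool) (A : Finset (Fin N)) : ℕ :=
  panInd A f + if b = true ∧ c ≠ f then panInd A c else 0

theorem sum_coinWeight_add_lightCount {N : ℕ} (f c : Fin N) (b : Bool) (A : Finset (Fin N)) :
    ∑ x ∈ A, coinWeight f c b x + lightCount f c b A = #A := by
  have h : ∀ y : Fin N, panInd A y = ∑ x ∈ A, if x = y then 1 else 0 := by
    intro y
    simp [panInd]
  have h2 : lightCount f c b A =
      ∑ x ∈ A, ((if x = f then 1 else 0) + if b = true ∧ c ≠ f ∧ x = c then 1 else 0) := by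
    rw [lightCount, sum_add_distrib, ← h]
    by_cases hb : b = true ∧ c ≠ f
    · simp [hb, h]
    · rw [if_neg hb]
      congr 1
      symm
      exact sum_eq_zero fun x _ => if_neg fun hx => hb ⟨hx.1, hx.2.1⟩
  rw [h2, ← sum_add_distrib, card_eq_sum_ones]
  refine sum_congr rfl fun x _ => ?_
  unfold coinWeight
  by_cases hf : x = f
  · subst hf
    by_cases hc : c = x
    · simp [hc]
    · simp [Ne.symm hc]
  · by_cases hc : x = c
    · subst hc
      cases b <;> simp [hf]
    · simp [hf, hc]

theorem weighOutcome_eq_compare_lightCount {N : ℕ} (f c : Fin N) (b : Bool)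
    {A B : Finset (Fin N)} (h : #A = #B) :
    weighOutcome f c b A B = compare (lightCount f c b B) (lightCount f c b A) := by
  have hA := sum_coinWeight_add_lightCount f c b A
  have hB := sum_coinWeight_add_lightCount f c b B
  unfold weighOutcome
  rcases lt_trichotomy (lightCount f c b B) (lightCount f c b A) with h1 | h1 | h1
  · rw [compare_lt_iff_lt.2 h1, compare_lt_iff_lt]
    omega
  · rw [compare_eq_iff_eq.2 h1, compare_eq_iff_eq]
    omega
  · rw [compare_gt_iff_gt.2 h1, compare_gt_iff_gt]
    omega

/-- `Solvable w R` says that the fake coin can be found within `w` balanced weighings when the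
pair (fake coin, chameleon) is known to satisfy `R`. A pair `(f, f)` stands for a fake coin whose
chameleon always behaves as a real coin; in this case the fake coin has to be identified
exactly. -/
inductive Solvable {N : ℕ} : ℕ → (Fin N → Fin N → Prop) → Prop
  | output {w : ℕ} {R : Fin N → Fin N → Prop} (S : Finset (Fin N)) (card_le : #S ≤ 2)
      (mem : ∀ f c, R f c → f ∈ S) (eq_singleton : ∀ f, R f f → S = {f}) : Solvable w R
  | weigh {w : ℕ} {R : Fin N → Fin N → Prop} (A B : Finset (Fin N)) (disj : Disjoint A B)
      (card_eq : #A = #B)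
      (child : ∀ o, Solvable w fun f c => R f c ∧ ∃ b, weighOutcome f c b A B = o) :
      Solvable (w + 1) R

theorem Solvable.exists_tree {N w : ℕ} {R : Fin N → Fin N → Prop} (h : Solvable w R) :
    ∃ t : FCTree N, t.WF ∧ t.depth ≤ w ∧
      ∀ f c, R f c → ∀ S, Reaches f c t S → #S ≤ 2 ∧ f ∈ S := by
  induction h with
  | output S hcard hmem _ =>
    refine ⟨.output S, trivial, Nat.zero_le _, fun f c hR S' hS' => ?_⟩
    cases hS'
    exact ⟨hcard, hmem f c hR⟩
  | weigh A B hdisj _ _ ih =>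
    choose t hwf hdepth ht using ih
    refine ⟨.weigh A B t, ⟨hdisj, hwf⟩, ?_, fun f c hR S hS => ?_⟩
    · have := hdepth .lt
      have := hdepth .eq
      have := hdepth .gt
      simp only [FCTree.depth]
      omega
    · cases hS with
      | weigh _ _ _ b _ h => exact ht _ f c ⟨hR, b, rfl⟩ S h

theorem Solvable.fcAlgorithm {N w : ℕ} (h : Solvable w fun _ _ : Fin N => True) :
    FCAlgorithm N w := by
  obtain ⟨t, hwf, hdepth, ht⟩ := h.exists_tree
  exact ⟨t, hwf, hdepth, fun f c _ => ht f c trivial⟩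

theorem Solvable.mono {N w : ℕ} {R R' : Fin N → Fin N → Prop} (h : Solvable w R)
    (hR : ∀ f c, R' f c → R f c) : Solvable w R' := by
  induction h generalizing R' with
  | output S hcard hmem heq =>
    exact .output S hcard (fun f c h => hmem f c (hR f c h)) fun f h => heq f (hR f f h)
  | weigh A B hdisj hcard _ ih =>
    exact .weigh A B hdisj hcard fun o => ih o fun f c h => ⟨hR f c h.1, h.2⟩

theorem Solvable.mono_weighings {N w w' : ℕ} {R : Fin N → Fin N → Prop} (h : Solvable w R)
    (hw : w ≤ w') : Solvable w' R := by
  induction h generalizing w' with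
  | output S hcard hmem heq => exact .output S hcard hmem heq
  | weigh A B hdisj hcard _ ih =>
    obtain ⟨w', rfl⟩ := Nat.exists_eq_succ_of_ne_zero (by omega : w' ≠ 0)
    exact .weigh A B hdisj hcard fun o => ih o (by omega)

/-! ### Replacing every coin by a group of three coins -/

/-- The `i`-th coin of the group `g`. -/
def groupCoin {N : ℕ} (g : Fin N) (i : Fin 3) : Fin (3 * N) :=
  ⟨3 * g.val + i.val, by omega⟩

theorem coinGroup_groupCoin {N : ℕ} (g : Fin N) (i : Fin 3) : coinGroup (groupCoin g i) = g := by
  ext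
  simp only [coinGroup, groupCoin]
  omega

theorem exists_eq_groupCoin {N : ℕ} (x : Fin (3 * N)) : ∃ i, x = groupCoin (coinGroup x) i := by
  refine ⟨⟨x.val % 3, Nat.mod_lt _ (by norm_num)⟩, ?_⟩
  ext
  simp only [coinGroup, groupCoin]
  omega

theorem groupCoin_inj {N : ℕ} {g g' : Fin N} {i i' : Fin 3} :
    groupCoin g i = groupCoin g' i' ↔ g = g' ∧ i = i' := by
  simp only [groupCoin, Fin.ext_iff]
  omega

theorem mem_expandPan {N : ℕ} {A : Finset (Fin N)} {x : Fin (3 * N)} :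
    x ∈ expandPan A ↔ coinGroup x ∈ A := by
  simp [expandPan]

theorem card_expandPan {N : ℕ} (A : Finset (Fin N)) : #(expandPan A) = 3 * #A := by
  have h : expandPan A = (A ×ˢ (univ : Finset (Fin 3))).image fun p => groupCoin p.1 p.2 := by
    ext x
    simp only [mem_expandPan, mem_image, mem_product, mem_univ, and_true, Prod.exists]
    constructor
    · intro hx
      obtain ⟨i, hi⟩ := exists_eq_groupCoin x
      exact ⟨_, i, hx, hi.symm⟩
    · rintro ⟨g, i, hg, rfl⟩
      rwa [coinGroup_groupCoin]
  rw [h, card_image_of_injective, card_product, card_univ, Fintype.card_fin, mul_comm]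
  rintro ⟨g, i⟩ ⟨g', i'⟩ h
  exact Prod.ext_iff.2 (groupCoin_inj.1 h)

theorem disjoint_expandPan {N : ℕ} {A B : Finset (Fin N)} (h : Disjoint A B) :
    Disjoint (expandPan A) (expandPan B) := by
  rw [disjoint_left] at h ⊢
  exact fun x hA hB => h (mem_expandPan.1 hA) (mem_expandPan.1 hB)

theorem exists_weighOutcome_coinGroup {N : ℕ} (f c : Fin (3 * N)) (b : Bool)
    {A B : Finset (Fin N)} (h : #A = #B) :
    ∃ b', weighOutcome (coinGroup f) (coinGroup c) b' A B =
      weighOutcome f c b (expandPan A) (expandPan B) := by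
  have h' : #(expandPan A) = #(expandPan B) := by rw [card_expandPan, card_expandPan, h]
  have hind : ∀ (D : Finset (Fin N)) (x : Fin (3 * N)),
      panInd (expandPan D) x = panInd D (coinGroup x) := fun D x => by
    simp [panInd, mem_expandPan]
  by_cases hfc : coinGroup c = coinGroup f
  · refine ⟨false, ?_⟩
    rw [weighOutcome_eq_compare_lightCount _ _ _ h, weighOutcome_eq_compare_lightCount _ _ _ h']
    simp only [lightCount, hind, hfc]
    unfold panInd
    split_ifs <;> simp_all <;> rfl
  · refine ⟨b, ?_⟩
    have hne : c ≠ f := fun h => hfc (h ▸ rfl)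
    rw [weighOutcome_eq_compare_lightCount _ _ _ h, weighOutcome_eq_compare_lightCount _ _ _ h']
    simp only [lightCount, hind, hfc, hne, ne_eq, not_false_eq_true, and_true]

theorem weighOutcome_singleton {N : ℕ} (f c : Fin N) (b : Bool) (x y : Fin N) :
    weighOutcome f c b {x} {y} = compare
      ((if f = y then 1 else 0) + if b = true ∧ c ≠ f then (if c = y then 1 else 0) else 0)
      ((if f = x then 1 else 0) + if b = true ∧ c ≠ f then (if c = x then 1 else 0) else 0) := by
  rw [weighOutcome_eq_compare_lightCount _ _ _ (by simp)]
  simp [lightCount, panInd]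

/-- The coin singled out inside a group by comparing its coins `0` and `1`, when the chameleon is
not involved. -/
def lightIndex : Ordering → Fin 3
  | .lt => 0
  | .eq => 2
  | .gt => 1

/-- The outcome of weighing coin `x` of a group against coin `y`, when coin `i` of the group is
fake and the position of the chameleon inside the group is `j` (`none` if it is outside). -/
def groupOutcome (i : Fin 3) (j : Option (Fin 3)) (b : Bool) (x y : Fin 3) : Ordering :=
  compare
    ((if i = y then 1 else 0) + if b = true ∧ j ≠ some i then (if j = some y then 1 else 0) else 0)
    ((if i = x then 1 else 0) + if b = true ∧ j ≠ some i then (if j = some x then 1 else 0) else 0)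

theorem weighOutcome_groupCoin {N : ℕ} (g : Fin N) (i x y : Fin 3) {c : Fin (3 * N)}
    {j : Option (Fin 3)} (hj : ∀ i', c = groupCoin g i' ↔ j = some i') (b : Bool) :
    weighOutcome (groupCoin g i) c b {groupCoin g x} {groupCoin g y} =
      groupOutcome i j b x y := by
  simp [weighOutcome_singleton, groupOutcome, groupCoin_inj, hj]

theorem exists_position {N : ℕ} (g : Fin N) (c : Fin (3 * N)) :
    ∃ j : Option (Fin 3), ∀ i, c = groupCoin g i ↔ j = some i := by
  by_cases h : coinGroup c = g
  · obtain ⟨i, hi⟩ := exists_eq_groupCoin c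
    refine ⟨some i, fun i' => ?_⟩
    rw [hi, h, groupCoin_inj]
    simp
  · refine ⟨none, fun i => ?_⟩
    simp only [reduceCtorEq, iff_false]
    rintro rfl
    exact h (coinGroup_groupCoin g i)

theorem eq_groupCoin_lightIndex {N : ℕ} {g : Fin N} {f c : Fin (3 * N)} (hf : coinGroup f = g)
    (hc : coinGroup c ≠ g) (b : Bool) :
    f = groupCoin g (lightIndex (weighOutcome f c b {groupCoin g 0} {groupCoin g 1})) := by
  obtain ⟨i, hi⟩ := exists_eq_groupCoin f
  rw [hf] at hi
  have hj : ∀ i', c = groupCoin g i' ↔ (none : Option (Fin 3)) = some i' := fun i' => by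
    simp only [reduceCtorEq, iff_false]
    rintro rfl
    exact hc (coinGroup_groupCoin g i')
  subst hi
  rw [weighOutcome_groupCoin g i 0 1 hj]
  congr 1
  clear hf
  revert i b
  decide

/-- The coins of a group that may be fake after the outcome `o` of weighing `0` against `1`,
followed by the outcome `o'` of weighing the lighter (or else `0`) of these against `2`. -/
def groupCandidates : Ordering → Ordering → Finset (Fin 3)
  | .lt, .lt => {0}
  | .lt, .eq => {0, 2}
  | .eq, .lt => {0, 1}
  | .eq, .eq => {1, 2}
  | .gt, .lt => {1}
  | .gt, .eq => {1, 2}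
  | _, .gt => {2}

/-- The coin that is weighed against coin `2` of a group after the outcome of weighing `0`
against `1`. -/
def secondCoin : Ordering → Fin 3
  | .gt => 1
  | _ => 0

theorem card_groupCandidates (o o' : Ordering) : #(groupCandidates o o') ≤ 2 := by
  cases o <;> cases o' <;> decide

theorem mem_groupCandidates : ∀ (i : Fin 3) (j : Option (Fin 3)) (b b' : Bool),
    i ∈ groupCandidates (groupOutcome i j b 0 1)
      (groupOutcome i j b' (secondCoin (groupOutcome i j b 0 1)) 2) := by
  decide

theorem groupCandidates_self : ∀ (i : Fin 3) (b b' : Bool),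
    groupCandidates (groupOutcome i (some i) b 0 1)
      (groupOutcome i (some i) b' (secondCoin (groupOutcome i (some i) b 0 1)) 2) = {i} := by
  decide

theorem Solvable.weigh_groupCoin {N w : ℕ} {R : Fin (3 * N) → Fin (3 * N) → Prop} (g : Fin N)
    {x y : Fin 3} (hxy : x ≠ y)
    (h : ∀ o, Solvable w fun f c =>
      R f c ∧ ∃ b, weighOutcome f c b {groupCoin g x} {groupCoin g y} = o) :
    Solvable (w + 1) R := by
  refine .weigh {groupCoin g x} {groupCoin g y} ?_ (by simp) h
  simpa [groupCoin_inj] using hxy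

theorem Solvable.two_groups {N : ℕ} {g g' : Fin N} {R : Fin N → Fin N → Prop}
    (hR : ∀ f c, R f c → (f = g ∨ f = g') ∧ c ≠ f) :
    Solvable 2 fun f c : Fin (3 * N) => R (coinGroup f) (coinGroup c) := by
  refine .weigh_groupCoin g (x := 0) (y := 1) (by decide) fun o =>
    .weigh_groupCoin g' (x := 0) (y := 1) (by decide) fun o' =>
    .output {groupCoin g (lightIndex o), groupCoin g' (lightIndex o')} card_le_two ?_ ?_
  · rintro f c ⟨⟨h, b, rfl⟩, b', rfl⟩
    obtain ⟨hf | hf, hc⟩ := hR _ _ h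
    · rw [hf] at hc
      rw [← eq_groupCoin_lightIndex hf hc]
      exact mem_insert_self _ _
    · rw [hf] at hc
      rw [← eq_groupCoin_lightIndex hf hc]
      exact mem_insert_of_mem (mem_singleton_self _)
  · rintro f ⟨⟨h, -⟩, -⟩
    exact absurd rfl (hR _ _ h).2

theorem Solvable.one_group {N : ℕ} {g : Fin N} {R : Fin N → Fin N → Prop}
    (hR : ∀ f c, R f c → f = g) :
    Solvable 2 fun f c : Fin (3 * N) => R (coinGroup f) (coinGroup c) := by
  refine .weigh_groupCoin g (x := 0) (y := 1) (by decide) fun o =>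
    .weigh_groupCoin g (x := secondCoin o) (y := 2) (by cases o <;> decide) fun o' =>
    .output ((groupCandidates o o').image (groupCoin g))
      (card_image_le.trans (card_groupCandidates o o')) ?_ ?_
  · rintro f c ⟨⟨h, b, rfl⟩, b', rfl⟩
    obtain ⟨i, hi⟩ := exists_eq_groupCoin f
    rw [hR _ _ h] at hi
    obtain ⟨j, hj⟩ := exists_position g c
    subst hi
    rw [weighOutcome_groupCoin g i _ _ hj, weighOutcome_groupCoin g i _ _ hj]
    exact mem_image_of_mem _ (mem_groupCandidates i j b b')
  · rintro f ⟨⟨h, b, rfl⟩, b', rfl⟩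
    obtain ⟨i, hi⟩ := exists_eq_groupCoin f
    rw [hR _ _ h] at hi
    subst hi
    have hj : ∀ i', groupCoin g i = groupCoin g i' ↔ some i = some i' := fun i' => by
      simp [groupCoin_inj]
    rw [weighOutcome_groupCoin g i _ _ hj, weighOutcome_groupCoin g i _ _ hj,
      groupCandidates_self, image_singleton]

theorem Solvable.scale {N w : ℕ} {R : Fin N → Fin N → Prop} (h : Solvable w R) :
    Solvable (w + 2) fun f c : Fin (3 * N) => R (coinGroup f) (coinGroup c) := by
  induction h with
  | @output w R S hcard hmem heq =>
    suffices Solvable 2 fun f c : Fin (3 * N) => R (coinGroup f) (coinGroup c) from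
      this.mono_weighings (Nat.le_add_left 2 w)
    by_cases h2 : #S = 2
    · obtain ⟨g, g', -, rfl⟩ := card_eq_two.1 h2
      refine .two_groups fun f c h => ⟨by simpa using hmem f c h, ?_⟩
      rintro rfl
      rw [heq c h, card_singleton] at h2
      omega
    · obtain ⟨g, hg⟩ | hS : (∃ g, S = {g}) ∨ S = ∅ := by
        rw [← card_eq_one, ← card_eq_zero]
        omega
      · exact .one_group fun f c h => by simpa [hg] using hmem f c h
      · exact .output ∅ (by simp) (fun f c h => by simpa [hS] using hmem _ _ h)
          fun f h => by simpa [hS] using hmem _ _ h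
  | weigh A B hdisj hcard _ ih =>
    refine .weigh (expandPan A) (expandPan B) (disjoint_expandPan hdisj)
      (by rw [card_expandPan, card_expandPan, hcard]) fun o => (ih o).mono ?_
    rintro f c ⟨h, b, rfl⟩
    exact ⟨h, exists_weighOutcome_coinGroup f c b hcard⟩

/-! ### Verifying an explicit strategy -/

/-- A sequence of balance weighings in which the pans are encoded by the binary digits of natural
numbers. -/
inductive WeighTree : Type
  | leaf : WeighTree
  | weigh (l r : ℕ) (lt eq gt : WeighTree) : WeighTree

namespace WeighTree

/-- A final weighing. -/
def last (l r : ℕ) : WeighTree := weigh l r leaf leaf leaf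

/-- Exchange the binary digits of `v` in the positions marked by `m` with those `k` positions
above. -/
def deltaSwap (k m v : ℕ) : ℕ :=
  let t := (v ^^^ (v >>> k)) &&& m
  v ^^^ t ^^^ (t <<< k)

/-- Exchange the coins in the positions marked by `m` with those `k` positions above. -/
def swap (k m : ℕ) : WeighTree → WeighTree
  | leaf => leaf
  | weigh l r lt eq gt =>
      weigh (deltaSwap k m l) (deltaSwap k m r) (swap k m lt) (swap k m eq) (swap k m gt)

/-- The `x`-th binary digit of `m`. -/
def digit (m x : ℕ) : ℕ := if m.testBit x then 1 else 0

/-- The outcome of a weighing for the pair `p` of the fake coin and the chameleon. -/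
def outcome (l r : ℕ) (p : ℕ × ℕ) (b : Bool) : Ordering :=
  compare (digit r p.1 + if b = true ∧ p.2 ≠ p.1 then digit r p.2 else 0)
    (digit l p.1 + if b = true ∧ p.2 ≠ p.1 then digit l p.2 else 0)

/-- The pairs from `ps` that are compatible with the outcome `o`. -/
def compatible (l r : ℕ) (ps : List (ℕ × ℕ)) (o : Ordering) : List (ℕ × ℕ) :=
  ps.filter fun p => outcome l r p false = o ∨ outcome l r p true = o

/-- Whether at most two coins occur as the fake coin of a pair in `ps`, and at most one if a pair
of equal coins occurs. -/
def checkLeaf : List (ℕ × ℕ) → Bool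
  | [] => true
  | p :: ps =>
      let q := (ps.find? fun q => q.1 != p.1).getD p
      (p :: ps).all fun s => (s.1 == p.1 || s.1 == q.1) && (s.1 != s.2 || p.1 == q.1)

/-- The number of binary digits of `m` equal to one among the first `N`. -/
def digitCount (N m : ℕ) : ℕ := ((List.range N).map (digit m)).sum

/-- Whether `t` solves the problem for `N` coins in `w` weighings when the pair of the fake coin
and the chameleon belongs to `ps`. -/
def check (N : ℕ) : WeighTree → ℕ → List (ℕ × ℕ) → Bool
  | leaf, _, ps => checkLeaf ps
  | weigh _ _ _ _ _, 0, _ => false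
  | weigh l r lt eq gt, w + 1, ps =>
      l &&& r == 0 && digitCount N l == digitCount N r &&
        check N lt w (compatible l r ps .lt) && check N eq w (compatible l r ps .eq) &&
        check N gt w (compatible l r ps .gt)

/-- The set of coins encoded by `m`. -/
def pan (N m : ℕ) : Finset (Fin N) := univ.filter fun x => m.testBit x.val = true

theorem panInd_pan {N m : ℕ} (x : Fin N) : panInd (pan N m) x = digit m x.val := by
  simp [panInd, pan, digit]

theorem card_pan (N m : ℕ) : #(pan N m) = digitCount N m := by
  rw [pan, card_filter, Fin.sum_univ_eq_sum_range fun x => if m.testBit x = true then 1 else 0]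
  rfl

theorem weighOutcome_pan {N l r : ℕ} (h : #(pan N l) = #(pan N r)) (f c : Fin N) (b : Bool) :
    weighOutcome f c b (pan N l) (pan N r) = outcome l r (f.val, c.val) b := by
  rw [weighOutcome_eq_compare_lightCount _ _ _ h]
  simp [lightCount, panInd_pan, outcome, Fin.ext_iff]

theorem solvable_of_checkLeaf {N w : ℕ} {ps : List (ℕ × ℕ)} (h : checkLeaf ps = true) :
    Solvable w fun f c : Fin N => (f.val, c.val) ∈ ps := by
  obtain ⟨a, b, hab⟩ : ∃ a b : ℕ, ∀ s ∈ ps, (s.1 = a ∨ s.1 = b) ∧ (s.1 = s.2 → a = b) := by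
    cases ps with
    | nil => exact ⟨0, 0, by simp⟩
    | cons p ps =>
      refine ⟨p.1, ((ps.find? fun q => q.1 != p.1).getD p).1, fun s hs => ?_⟩
      have := List.all_eq_true.1 h s hs
      simp only [Bool.and_eq_true, Bool.or_eq_true, beq_iff_eq, bne_iff_ne] at this
      exact ⟨this.1, fun hs => this.2.resolve_left (not_not_intro hs)⟩
  by_cases hps : ∃ f : Fin N, (f.val, f.val) ∈ ps
  · obtain ⟨f, hf⟩ := hps
    have hfa : f.val = a ∨ f.val = b := (hab _ hf).1
    have hab' : a = b := (hab _ hf).2 rfl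
    have huniq : ∀ f' c' : Fin N, (f'.val, c'.val) ∈ ps → f' = f := fun f' c' h' => by
      have : f'.val = a ∨ f'.val = b := (hab _ h').1
      omega
    exact .output {f} (by simp) (fun f' c' h' => by simp [huniq f' c' h'])
      fun f' h' => by rw [huniq f' f' h']
  · refine .output (univ.filter fun x => x.val = a ∨ x.val = b) ?_ ?_ ?_
    · calc _ ≤ #({a, b} : Finset ℕ) :=
            card_le_card_of_injOn Fin.val (by intro x; simp) Fin.val_injective.injOn
        _ ≤ 2 := card_le_two
    · intro f c hfc
      simpa using (hab _ hfc).1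
    · exact fun f hf => absurd ⟨f, hf⟩ hps

theorem solvable_of_check {N w : ℕ} {t : WeighTree} {ps : List (ℕ × ℕ)}
    (h : t.check N w ps = true) : Solvable w fun f c : Fin N => (f.val, c.val) ∈ ps := by
  induction t generalizing w ps with
  | leaf => exact solvable_of_checkLeaf (by simpa [check] using h)
  | weigh l r lt eq gt ihlt iheq ihgt =>
    cases w with
    | zero => simp [check] at h
    | succ w =>
      simp only [check, Bool.and_eq_true, beq_iff_eq] at h
      obtain ⟨⟨⟨⟨hlr, hcount⟩, hlt⟩, heq⟩, hgt⟩ := h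
      have hcard : #(pan N l) = #(pan N r) := by rw [card_pan, card_pan, hcount]
      refine .weigh (pan N l) (pan N r) ?_ hcard fun o => ?_
      · rw [disjoint_left]
        intro x hl hr
        simp only [pan, mem_filter, mem_univ, true_and] at hl hr
        have := congrArg (Nat.testBit · x.val) hlr
        simp [hl, hr] at this
      · have hcompat : Solvable w fun f c : Fin N => (f.val, c.val) ∈ compatible l r ps o := by
          cases o
          exacts [ihlt hlt, iheq heq, ihgt hgt]
        refine hcompat.mono ?_
        rintro f c ⟨hps, b, rfl⟩
        rw [weighOutcome_pan hcard, compatible, List.mem_filter]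
        refine ⟨hps, ?_⟩
        cases b <;> simp

end WeighTree

/-! ### The strategy for 36 coins -/

namespace WeighTree

/-- The strategy after the outcomes `<`, `<`. -/
def tree36LtLt : WeighTree :=
  .weigh 117440512 939524096
   (.weigh 63 29120
    (.weigh 67123264 16779136
     (.last 16780218 521220)
     (.last 4666 3524)
     (.last 2041 67368964))
    (.weigh 29185 2246
     (.last 33554488 67123200)
     (.last 67108864 33554432)
     (.last 33554489 67114752))
    (.weigh 33555001 67116038
     (.last 83888253 128770)
     (.last 1855 522368)
     (.last 50332287 523520)))
   (.weigh 448 3584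
    (.weigh 640 34359738432
     (.last 2 4)
     (.last 34359738372 2050)
     (.last 34359738369 260))
    (.weigh 12884904068 1347 .leaf
     (.last 34359738370 257)
     (.last 64424509442 1857))
    (.weigh 2048 1024
     (.last 4 2)
     (.last 4 2)
     (.last 4 2)))
   (.weigh 134217728 268435456
    (.weigh 2564 1154
     (.last 2048 4)
     (.last 68 4097)
     (.last 1024 128))
    (.weigh 1156 577
     (.last 1024 128)
     (.last 2048 256)
     (.last 512 64))
    (.weigh 321 2562
     (.last 256 64)
     (.last 1024 128)
     (.last 2048 512)))

/-- The strategy after the outcomes `<`, `=`. -/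
def tree36LtEq : WeighTree :=
  .weigh 32704 1056964664
   (.weigh 29183 16748032
    (.weigh 7935 16769280
     (.last 8063 16769152)
     (.last 16785023 8380800) .leaf)
    (.weigh 28799 68232937728
     (.last 68652368640 33523840)
     (.last 1056965120 66572026880)
     (.last 30975 67077120))
    (.weigh 6143 16771072
     (.last 7167 16770048)
     (.last 16782335 8383488) .leaf))
   (.weigh 7516196865 60129542336
    (.weigh 2147483712 4294971392
     (.last 1073741890 12289)
     (.last 2 1)
     (.last 1 4))
    (.weigh 42949675264 2147487750
     (.last 30064771072 1073744128)
     (.last 2502 62976)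
     (.last 258048 63350767620))
    (.weigh 34359743488 21474836544
     (.last 25769805312 28674)
     (.last 28676 960)
     (.last 4294967360 4100)))
   (.weigh 7 117440512
    (.weigh 285212674 536870980
     (.last 570425376 134217808)
     (.last 268435488 536870920)
     (.last 150994963 872415328))
    (.weigh 536874944 385875975
     (.last 402653216 84)
     (.last 8 32)
     (.last 96 134217736))
    (.weigh 33554500 201326594
     (.last 536871008 201326608)
     (.last 268435466 208)
     (.last 167772196 285212690)))

/-- The strategy after the outcomes `=`, `<`. -/
def tree36EqLt : WeighTree :=
  .weigh 12901740545 51574145026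
   (.weigh 4516216832 8602529808
    (.weigh 4298131473 43037790208
     (.last 4429185024 2098176)
     (.last 134225920 2214592512)
     (.last 67108864 134217728))
    (.weigh 16483 4445964296
     (.last 34359771136 8589934596)
     (.last 8791261184 34359771140)
     (.last 16777280 32776))
    (.weigh 8602550272 53687095296
     (.last 8589967360 34363932672)
     (.last 51539607556 150994952)
     (.last 8589934596 34359738376)))
   (.weigh 12919574644 17384211328
    (.weigh 36795646249 9273609428
     (.last 2148535896 35022438560)
     (.last 680525844 12985565728)
     (.last 1082672088 30987521024))
    (.weigh 36666605833 1413522048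
     (.last 1082130440 34443624448)
     (.last 209731586 17184063625)
     (.last 71303173 3355475968))
    (.weigh 15770583696 17199016010
     (.last 603979840 34510733312)
     (.last 201326592 34360262656)
     (.last 51623493632 136315400)))
   (.weigh 7548928 51774488624
    (.weigh 28512970880 5577938176
     (.last 11294213241 56007100802)
     (.last 39602637828 29074915928)
     (.last 432836712 32247079937))
    (.weigh 17356029956 35434005000
     (.last 1074003972 17188257794)
     (.last 30131879936 34393554946)
     (.last 10469253564 51781501442))
    (.weigh 12239000656 611363744
     (.last 22013815041 2181072488)
     (.last 17179923952 46977264128)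
     (.last 27137146880 2181038704)))

/-- The strategy after the outcomes `=`, `=`. -/
def tree36EqEq : WeighTree :=
  .weigh 13170176000 52111015936
   (.weigh 469767936 16106153984
    (.weigh 10754195712 4433380352
     (.last 60130099200 7801405440)
     (.last 3573547008 60130099200)
     (.last 34763047432 10804597120))
    (.weigh 16592705536 51589627904
     (.last 36524032000 30064779264)
     (.last 17951621376 4584375298)
     (.last 806879488 12884943872))
    (.weigh 35433504768 13287555072
     (.last 1090519040 8589942784)
     (.last 64424509440 2566914048)
     (.last 8589934592 4294967296)))
   (.weigh 25451036928 42953802240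
    (.weigh 21488468736 1140850932
     (.last 2291141852 66320334883)
     (.last 45298485283 6080256)
     (.last 1207971801 2218643462))
    (.weigh 28424800256 38665225440
     (.last 2600468480 38658902080)
     (.last 41662022656 17255430148)
     (.last 17192453120 38956695552))
    (.weigh 79692288 2282750976
     (.last 948719645 2203231330)
     (.last 2283801730 65569554432)
     (.last 30071714816 36365928512)))
   (.weigh 1006703088 51555525120
    (.weigh 34432212484 20435435961
     (.last 18257476096 50428379136)
     (.last 36515722672 31414698496)
     (.last 20099135500 12918097408))
    (.weigh 64492213772 3270830080
     (.last 1086123009 67566047232)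
     (.last 51614644224 17104503040)
     (.last 2180034560 64626116608))
    (.weigh 54225072128 5729684480
     (.last 33646970368 34360396031)
     (.last 8594300928 57998835712)
     (.last 68685924352 33354240)))

/-- The strategy after the outcome `<`. -/
def tree36Lt : WeighTree :=
  weigh 1056964615 67645734968 tree36LtLt tree36LtEq
    ((tree36LtLt.swap 3 7).swap 6 1056964608)

/-- The strategy after the outcome `=`. -/
def tree36Eq : WeighTree :=
  weigh 251658255 4026532080 tree36EqLt tree36EqEq (tree36EqLt.swap 4 251658255)

/-- A strategy for 36 coins. -/
def tree36 : WeighTree := weigh 4095 16773120 tree36Lt tree36Eq (tree36Lt.swap 12 4095)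

theorem check_tree36 :
    tree36.check 36 6 (List.product (List.range 36) (List.range 36)) = true := by
  decide +kernel

end WeighTree

theorem solvable_thirtySix_mul_three_pow (k : ℕ) :
    Solvable (6 + 2 * k) fun _ _ : Fin (36 * 3 ^ k) => True := by
  induction k with
  | zero =>
    refine (WeighTree.solvable_of_check WeighTree.check_tree36).mono fun f c _ => ?_
    have hf := f.isLt
    have hc := c.isLt
    exact List.pair_mem_product.2 ⟨List.mem_range.2 hf, List.mem_range.2 hc⟩
  | succ k ih =>
    have h : 36 * 3 ^ (k + 1) = 3 * (36 * 3 ^ k) := by ring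
    rw [h]
    exact ih.scale

/-- For every integer k ≥ 0 there is an FC-algorithm in 6 + 2k weighings for
36·3^k coins, i.e. N(6+2k) ≥ 36·3^k. -/
theorem fc_N_even_lower_bound (k : ℕ) : FCAlgorithm (36 * 3 ^ k) (6 + 2 * k) :=
  (solvable_thirtySix_mul_three_pow k).fcAlgorithm
end
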